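/- arXiv:math/0606467 — 2 statements merged into one kernel-verified Lean document; each statement's English description precedes it below -/
import Mathlib

section
/- Let λ = p × q be the rectangular partition of n = pq with p parts equal to q. Fix k ≥ 1 with k ≤ n, let μ be a partition of k, and fix a permutation w_μ ∈ S_k of cycle type μ. Then the normalized character F_μ(p;q) = χ̂^{p×q}(μ,1^{n-k}) satisfies F_μ(p;q) = (−1)^k Σ_{(u,v): u w_μ = v} p^{κ(u)} (−q)^{κ(v)}, where the sum ranges over all k! pairs (u,v) ∈ S_k × S_k with u w_μ = v (equivalently, v = u w_μ ranges over all u ∈ S_k), and κ(w) denotes the number of cycles of the permutation w in its disjoint cycle decomposition (including fixed points). -/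
open Equiv Finset

/-- The `r`-th power sum polynomial in `n` variables. -/
noncomputable def psum (n r : ℕ) : MvPolynomial (Fin n) ℤ :=
  ∑ i : Fin n, MvPolynomial.X i ^ r

/-- The Vandermonde product `∏_{i<j} (x_i - x_j)`. -/
noncomputable def vdm (n : ℕ) : MvPolynomial (Fin n) ℤ :=
  ∏ i : Fin n, ∏ j ∈ Finset.univ.filter (fun j => i < j),
    (MvPolynomial.X i - MvPolynomial.X j)

/-- The `i`-th largest part of a partition (`0`-indexed; `0` if `i` exceeds the
number of parts). -/
def nthPart {n : ℕ} (lam : n.Partition) (i : ℕ) : ℕ :=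
  ((lam.parts.sort (· ≤ ·)).reverse).getD i 0

/-- The value `χ^λ(μ)` of the irreducible character of the symmetric group `S_n`
indexed by the partition `λ` of `n` on permutations of cycle type `μ`, defined via
the Frobenius character formula: `χ^λ(μ)` is the coefficient of
`x^{λ₁+n-1} x₂^{λ₂+n-2} ⋯ xₙ^{λₙ}` in `∏_{i<j}(x_i-x_j) · ∏_r p_{μ_r}(x)`. -/
noncomputable def chi (n : ℕ) (lam mu : n.Partition) : ℤ :=
  MvPolynomial.coeff
    (Finsupp.equivFunOnFinite.symm fun i : Fin n => nthPart lam i + (n - 1 - i))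
    (vdm n * (mu.parts.map (psum n)).prod)

/-- The partition `(μ, 1^{n-k})` of `n` obtained from a partition `μ` of `k ≤ n`
by appending `n - k` parts equal to `1`. -/
def padOnes {k : ℕ} (n : ℕ) (h : k ≤ n) (mu : Nat.Partition k) : Nat.Partition n where
  parts := mu.parts + Multiset.replicate (n - k) 1
  parts_pos := by
    intro i hi
    rcases Multiset.mem_add.mp hi with h' | h'
    · exact mu.parts_pos h'
    · simpa [Multiset.eq_of_mem_replicate h'] using Nat.one_pos
  parts_sum := by
    simp [Multiset.sum_replicate, mu.parts_sum]
    omega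

/-- The partition of `n` into `n` parts equal to `1`. -/
def onesPartition (n : ℕ) : Nat.Partition n where
  parts := Multiset.replicate n 1
  parts_pos := by
    intro i hi
    simpa [Multiset.eq_of_mem_replicate hi] using Nat.one_pos
  parts_sum := by simp [Multiset.sum_replicate]

/-- The normalized character `χ̂^λ(μ, 1^{n-k}) = (n)_k χ^λ(μ,1^{n-k}) / χ^λ(1^n)`. -/
noncomputable def chihat {k : ℕ} (n : ℕ) (h : k ≤ n) (lam : n.Partition)
    (mu : Nat.Partition k) : ℚ :=
  (n.descFactorial k : ℚ) * (chi n lam (padOnes n h mu) : ℚ) / (chi n lam (onesPartition n) : ℚ)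

/-- `n = ∑ pᵢ qᵢ`, the size of a union of `m` rectangles `pᵢ × qᵢ`. -/
def rectN (m : ℕ) (p q : Fin m → ℕ) : ℕ := ∑ i : Fin m, p i * q i

/-- The partition whose Young diagram is the union of `m` rectangles of sizes
`pᵢ × qᵢ` (with `q₁ ≥ ⋯ ≥ q_m`): it has `pᵢ` parts equal to `qᵢ` for each `i`. -/
def rectShape (m : ℕ) (p q : Fin m → ℕ) (hq : ∀ i, 0 < q i) :
    Nat.Partition (rectN m p q) where
  parts := ∑ i : Fin m, Multiset.replicate (p i) (q i)
  parts_pos := by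
    intro j hj
    rw [Multiset.mem_sum] at hj
    obtain ⟨i, -, hji⟩ := hj
    rw [Multiset.eq_of_mem_replicate hji]
    exact hq i
  parts_sum := by
    rw [Multiset.sum_sum]
    simp [Multiset.sum_replicate, rectN, mul_comm]

/-- The `p × q` rectangular partition of `n = p * q`: `p` parts equal to `q`. -/
def rectangle (p q : ℕ) (hq : 0 < q) : Nat.Partition (p * q) where
  parts := Multiset.replicate p q
  parts_pos := by
    intro i hi
    rw [Multiset.eq_of_mem_replicate hi]
    exact hq
  parts_sum := by simp [Multiset.sum_replicate]

/-- `κ(w)`, the number of cycles of `w` (counting fixed points), computed as the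
number of elements that are minimal in their cycle. -/
noncomputable def kappa {k : ℕ} (w : Equiv.Perm (Fin k)) : ℕ :=
  Nat.card {x : Fin k // ∀ y, w.SameCycle x y → x ≤ y}

namespace RectangleCharacter

open MvPolynomial hiding psum

/-- The linear functional on polynomials sending `∏ᵢ xᵢ ^ aᵢ` to the product of the falling
factorials `(eᵢ)_{aᵢ}`. -/
noncomputable def fallFunctional {p : ℕ} (e : Fin p → ℕ) : MvPolynomial (Fin p) ℤ →ₗ[ℤ] ℤ :=
  (basisMonomials (Fin p) ℤ).constr ℤ fun a => ∏ i, ((e i).descFactorial (a i) : ℤ)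

theorem fallFunctional_monomial {p : ℕ} (e : Fin p → ℕ) (a : Fin p →₀ ℕ) (c : ℤ) :
    fallFunctional e (monomial a c) = c * ∏ i, ((e i).descFactorial (a i) : ℤ) := by
  have h : (monomial a c : MvPolynomial (Fin p) ℤ) = c • basisMonomials (Fin p) ℤ a := by
    simp [smul_monomial]
  rw [h, map_smul, fallFunctional, Module.Basis.constr_basis, smul_eq_mul]

/-- The derivation `∑ᵢ xᵢ ^ (m + 1) ∂ᵢ`. -/
noncomputable def powDer (p m : ℕ) :
    Derivation ℤ (MvPolynomial (Fin p) ℤ) (MvPolynomial (Fin p) ℤ) :=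
  mkDerivation ℤ fun i => X i ^ (m + 1)

theorem powDer_X (p m : ℕ) (i : Fin p) : powDer p m (X i) = X i ^ (m + 1) :=
  mkDerivation_X _ _ _

theorem descFactorial_succ_cast (n a : ℕ) :
    ((n.descFactorial (a + 1) : ℕ) : ℤ) = ((n : ℤ) - a) * n.descFactorial a := by
  rw [Nat.descFactorial_succ]
  rcases le_or_gt a n with h | h
  · push_cast [h]; ring
  · simp [Nat.descFactorial_of_lt h]

theorem X_pow_mul_monomial {p : ℕ} (i : Fin p) (n : ℕ) (a : Fin p →₀ ℕ) (c : ℤ) :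
    (X i ^ n * monomial a c : MvPolynomial (Fin p) ℤ) = monomial (a + Finsupp.single i n) c := by
  rw [X_pow_eq_monomial, monomial_mul, one_mul, add_comm]

theorem powDer_monomial (p m : ℕ) (a : Fin p →₀ ℕ) (c : ℤ) :
    powDer p m (monomial a c) = ∑ i, monomial (a + Finsupp.single i m) (c * a i) := by
  rw [powDer, mkDerivation_monomial, Finsupp.sum_fintype _ _ (by simp), Finset.smul_sum]
  refine Finset.sum_congr rfl fun i _ => ?_
  rw [smul_eq_mul, mul_comm (monomial _ _), X_pow_mul_monomial, smul_monomial, smul_eq_mul]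
  rcases Nat.eq_zero_or_pos (a i) with h | h
  · simp [h]
  · congr 2
    ext j
    rcases eq_or_ne j i with rfl | hj
    · simp; omega
    · simp [hj.symm]

theorem fallFunctional_monomial_add_single {p : ℕ} (e : Fin p → ℕ) (a : Fin p →₀ ℕ) (i : Fin p)
    (n : ℕ) (c : ℤ) :
    fallFunctional e (monomial (a + Finsupp.single i n) c) =
      c * ((e i).descFactorial (a i + n) *
        ∏ j ∈ Finset.univ.erase i, ((e j).descFactorial (a j) : ℤ)) := by
  rw [fallFunctional_monomial, ← Finset.mul_prod_erase _ _ (Finset.mem_univ i)]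
  congr 2
  · simp
  · refine Finset.prod_congr rfl fun j hj => ?_
    simp [(Finset.ne_of_mem_erase hj).symm]

/-- Integration by parts. -/
theorem fallFunctional_powDer {p : ℕ} (M m : ℕ) (h : MvPolynomial (Fin p) ℤ) :
    fallFunctional (fun _ => M)
      (powDer p m h + ((m : ℤ) - M) • (psum p m * h) + psum p (m + 1) * h) = 0 := by
  induction h using MvPolynomial.induction_on' with
  | monomial a c =>
    rw [powDer_monomial, psum, psum, Finset.sum_mul, Finset.sum_mul, Finset.smul_sum,
      ← Finset.sum_add_distrib, ← Finset.sum_add_distrib, map_sum]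
    refine Finset.sum_eq_zero fun i _ => ?_
    rw [X_pow_mul_monomial, X_pow_mul_monomial, map_add, map_add, map_smul,
      fallFunctional_monomial_add_single, fallFunctional_monomial_add_single,
      fallFunctional_monomial_add_single, ← add_assoc, descFactorial_succ_cast, smul_eq_mul]
    push_cast
    ring
  | add f g hf hg =>
    rw [← add_zero (0 : ℤ)]
    nth_rewrite 1 [← hf]
    rw [← hg, ← map_add]
    congr 1
    simp only [map_add, mul_add, smul_add]
    ring

theorem derivation_prod_of_eigen {R A ι : Type*} [CommRing R] [CommRing A] [Algebra R A]
    (D : Derivation R A A) (s : Finset ι) (f g : ι → A) (h : ∀ i ∈ s, D (f i) = g i * f i) :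
    D (∏ i ∈ s, f i) = (∑ i ∈ s, g i) * ∏ i ∈ s, f i := by
  classical
  induction s using Finset.induction_on with
  | empty => simp
  | insert a s ha ih =>
    rw [Finset.prod_insert ha, Finset.sum_insert ha, D.leibniz,
      ih fun i hi => h i (Finset.mem_insert_of_mem hi), h a (Finset.mem_insert_self a s)]
    simp only [smul_eq_mul]
    ring

theorem two_mul_sum_lt {A : Type*} [CommRing A] {p : ℕ} (H : Fin p → Fin p → A)
    (hH : ∀ i j, H i j = H j i) :
    2 * ∑ i, ∑ j ∈ Finset.univ.filter (fun j => i < j), H i j =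
      ∑ i, ∑ j, H i j - ∑ i, H i i := by
  have h1 : ∑ i, ∑ j ∈ Finset.univ.filter (fun j => i < j), H i j =
      ∑ i, ∑ j ∈ Finset.univ.filter (fun j => j < i), H i j := by
    simp only [Finset.sum_filter]
    rw [Finset.sum_comm]
    exact Finset.sum_congr rfl fun i _ => Finset.sum_congr rfl fun j _ => by rw [hH]
  have h2 : ∑ i, ∑ j, H i j = ∑ i, (∑ j ∈ Finset.univ.filter (fun j => i < j), H i j +
      ∑ j ∈ Finset.univ.filter (fun j => j < i), H i j + H i i) := by
    refine Finset.sum_congr rfl fun i _ => ?_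
    simp only [Finset.sum_filter]
    rw [← Finset.sum_add_distrib]
    have : H i i = ∑ j, if j = i then H i j else 0 := by simp
    rw [this, ← Finset.sum_add_distrib]
    refine Finset.sum_congr rfl fun j _ => ?_
    rcases lt_trichotomy i j with h | h | h
    · simp [h, h.not_gt, h.ne']
    · simp [h]
    · simp [h, h.not_gt, h.ne]
  rw [h2, Finset.sum_add_distrib, Finset.sum_add_distrib, ← h1]
  ring

theorem powDer_vdm (p m : ℕ) :
    2 * powDer p m (vdm p) =
      (∑ s ∈ Finset.range m, psum p (s + 1) * psum p (m - 1 - s) +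
        ((p : ℤ) - 1 - m) • psum p m) * vdm p := by
  set H : Fin p → Fin p → MvPolynomial (Fin p) ℤ :=
    fun i j => ∑ s ∈ Finset.range (m + 1), X i ^ s * X j ^ (m - s) with hHdef
  have hder : ∀ i j : Fin p, powDer p m (X i - X j) = H i j * (X i - X j) := fun i j => by
    rw [map_sub, powDer_X, powDer_X, ← (Commute.all (X i) (X j)).geom_sum₂_mul]
    simp [hHdef]
  have hsymm : ∀ i j, H i j = H j i := fun i j => by
    simp only [hHdef]
    rw [← Finset.sum_range_reflect]
    refine Finset.sum_congr rfl fun s hs => ?_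
    have hs' : s ≤ m := by simpa [Nat.lt_succ_iff] using hs
    rw [mul_comm, show m - (m + 1 - 1 - s) = s by omega, show m + 1 - 1 - s = m - s by omega]
  have h1 : powDer p m (vdm p) =
      (∑ i, ∑ j ∈ Finset.univ.filter (fun j => i < j), H i j) * vdm p := by
    unfold vdm
    exact derivation_prod_of_eigen _ _ _ _ fun i _ =>
      derivation_prod_of_eigen _ _ _ _ fun j _ => hder i j
  have hdiag : ∑ i, H i i = ((m : ℤ) + 1) • psum p m := by
    rw [psum, Finset.smul_sum]
    refine Finset.sum_congr rfl fun i _ => ?_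
    simp only [hHdef]
    rw [Finset.sum_congr rfl fun s hs => by
      rw [← pow_add, Nat.add_sub_cancel' (Nat.lt_succ_iff.mp (Finset.mem_range.mp hs))]]
    simp [add_mul]
  have hall : ∑ i, ∑ j, H i j = ∑ s ∈ Finset.range (m + 1), psum p s * psum p (m - s) := by
    simp only [hHdef, psum, Finset.sum_mul_sum]
    rw [Finset.sum_congr rfl fun i _ => Finset.sum_comm, Finset.sum_comm]
  rw [h1, ← mul_assoc, two_mul_sum_lt H hsymm, hdiag, hall, Finset.sum_range_succ']
  congr 1
  have hz : psum p 0 = (p : MvPolynomial (Fin p) ℤ) := by simp [psum]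
  rw [hz]
  have hidx : ∀ s, m - (s + 1) = m - 1 - s := fun s => by omega
  rw [Finset.sum_congr rfl fun s _ => by rw [hidx]]
  simp only [Nat.sub_zero, zsmul_eq_mul, Int.cast_sub, Int.cast_add, Int.cast_natCast, Int.cast_one]
  ring

/-- The Schwinger-Dyson (loop) equation of the functional `f ↦ E (vdm ^ 2 * f)`. -/
theorem loop_equation (p q m : ℕ) (hp : 0 < p) (R : MvPolynomial (Fin p) ℤ) :
    fallFunctional (fun _ => q + p - 1) (vdm p ^ 2 * (psum p (m + 1) * R)) =
      (q : ℤ) * fallFunctional (fun _ => q + p - 1) (vdm p ^ 2 * (psum p m * R)) -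
      ∑ s ∈ Finset.range m, fallFunctional (fun _ => q + p - 1)
        (vdm p ^ 2 * (psum p (s + 1) * psum p (m - 1 - s) * R)) -
      fallFunctional (fun _ => q + p - 1) (vdm p ^ 2 * powDer p m R) := by
  have h := fallFunctional_powDer (p := p) (q + p - 1) m (vdm p ^ 2 * R)
  rw [← map_sum, ← smul_eq_mul (q : ℤ), ← map_smul, ← map_sub, ← map_sub, ← sub_eq_zero, ← map_sub, ← h]
  congr 1
  have h2 : powDer p m (vdm p ^ 2 * R) =
      vdm p ^ 2 * powDer p m R + R * vdm p * (2 * powDer p m (vdm p)) := by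
    rw [Derivation.leibniz, Derivation.leibniz_pow]
    simp only [smul_eq_mul, nsmul_eq_mul]
    push_cast
    ring
  have hc : ((q + p - 1 : ℕ) : ℤ) = q + p - 1 := by omega
  rw [h2, powDer_vdm, hc, ← Finset.mul_sum, ← Finset.sum_mul]
  simp only [zsmul_eq_mul]
  push_cast
  ring

/-- The number of cycles of a permutation, fixed points included. -/
noncomputable def numCycles {α : Type} (w : Perm α) : ℕ :=
  Nat.card (Quotient (Perm.SameCycle.setoid w))

theorem eq_of_sameCycle {α R : Type} {w : Perm α} {c : α → R} (hc : ∀ x, c (w x) = c x) {x y : α}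
    (h : w.SameCycle x y) : c x = c y := by
  have hinv : ∀ x, c (w⁻¹ x) = c x := fun x => by
    simpa using (hc (w⁻¹ x)).symm
  obtain ⟨n, rfl⟩ := h
  induction n using Int.induction_on with
  | zero => simp
  | succ n ih => rw [add_comm, zpow_add, zpow_one, Perm.mul_apply, hc, ← ih]
  | pred n ih => rw [sub_eq_add_neg, add_comm, zpow_add, zpow_neg_one, Perm.mul_apply, hinv, ← ih]

/-- Functions invariant under `w` are functions on the set of cycles of `w`. -/
def invariantEquiv {α : Type} (w : Perm α) (R : Type) :
    {c : α → R // ∀ x, c (w x) = c x} ≃ (Quotient (Perm.SameCycle.setoid w) → R) where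
  toFun c := Quotient.lift c.1 fun _ _ h => eq_of_sameCycle c.2 h
  invFun f := ⟨fun x => f (Quotient.mk (Perm.SameCycle.setoid w) x), fun x =>
    congrArg f (Quotient.sound (Perm.sameCycle_apply_left.mpr (Perm.SameCycle.refl w x)))⟩
  left_inv _ := rfl
  right_inv f := by
    ext x
    induction x using Quotient.ind
    rfl

theorem card_invariant {α : Type} [Finite α] (w : Perm α) (R : Type) :
    Nat.card {c : α → R // ∀ x, c (w x) = c x} = Nat.card R ^ numCycles w := by
  rw [Nat.card_congr (invariantEquiv w R), Nat.card_fun, numCycles]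

theorem numCycles_eq_add {α β : Type} [Finite α] [Finite β] {w : Perm α} {v : Perm β} (n : ℕ)
    (e : {c : α → Bool // ∀ x, c (w x) = c x} ≃
      {c : β → Bool // ∀ x, c (v x) = c x} × (Fin n → Bool)) :
    numCycles w = numCycles v + n := by
  have h := Nat.card_congr e
  rw [Nat.card_prod, card_invariant, card_invariant, Nat.card_fun, Nat.card_eq_fintype_card,
    Nat.card_eq_fintype_card, Fintype.card_bool, Fintype.card_fin, ← pow_add] at h
  exact Nat.pow_right_injective le_rfl h

theorem numCycles_permCongr {α β : Type} [Finite α] [Finite β] (e : α ≃ β) (w : Perm α) :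
    numCycles (e.permCongr w) = numCycles w := by
  refine numCycles_eq_add 0 (((e.symm.arrowCongr (Equiv.refl Bool)).subtypeEquiv fun c => ?_).trans
    (Equiv.prodUnique _ _).symm)
  refine ⟨fun h x => ?_, fun h x => ?_⟩
  · simpa using h (e x)
  · simpa using h (e.symm x)

theorem numCycles_mul_comm {α : Type} [Finite α] (a b : Perm α) :
    numCycles (a * b) = numCycles (b * a) := by
  rw [← numCycles_permCongr b (a * b)]
  congr 1
  ext x
  simp

theorem numCycles_optionCongr {α : Type} [Finite α] (σ : Perm α) :
    numCycles (optionCongr σ : Perm (Option α)) = numCycles σ + 1 := by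
  refine numCycles_eq_add 1
    { toFun := fun c => (⟨fun x => c.1 (some x), fun x => c.2 (some x)⟩, fun _ => c.1 none)
      invFun := fun c => ⟨fun x => x.elim (c.2 0) c.1.1, fun x => ?_⟩
      left_inv := fun c => ?_
      right_inv := fun c => ?_ }
  · cases x with
    | none => rfl
    | some x => exact c.1.2 x
  · ext x
    cases x <;> rfl
  · refine Prod.ext rfl (funext fun i => ?_)
    rw [Subsingleton.elim i 0]
    rfl

theorem numCycles_swap_mul_optionCongr {α : Type} [Finite α] [DecidableEq α] (a : α)
    (σ : Perm α) : numCycles (swap none (some a) * optionCongr σ) = numCycles σ := by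
  have hto : ∀ c : Option α → Bool,
      (∀ x, c ((swap none (some a) * optionCongr σ : Perm (Option α)) x) = c x) →
        ∀ x, c (some (σ x)) = c (some x) := fun c hc x => by
    have h0 := hc none
    have h := hc (some x)
    simp only [Perm.mul_apply, optionCongr_apply, Option.map_none, Option.map_some,
      swap_apply_left] at h0 h
    rcases eq_or_ne (σ x) a with hx | hx
    · rw [← h, hx, swap_apply_right, h0]
    · rwa [swap_apply_of_ne_of_ne (by simp) (by simpa using hx)] at h
  have hinv : ∀ c : α → Bool, (∀ x, c (σ x) = c x) → ∀ x : Option α,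
      ((swap none (some a) * optionCongr σ : Perm (Option α)) x).elim (c a) c =
        x.elim (c a) c := fun c hc x => by
    cases x with
    | none => simp
    | some x =>
      simp only [Perm.mul_apply, optionCongr_apply, Option.map_some, Option.elim_some]
      rw [← hc x]
      rcases eq_or_ne (σ x) a with hx | hx
      · rw [hx, swap_apply_right, Option.elim_none]
      · rw [swap_apply_of_ne_of_ne (by simp) (by simpa using hx), Option.elim_some]
  refine numCycles_eq_add 0 (Equiv.trans
    { toFun := fun c => ⟨fun x => c.1 (some x), hto c.1 c.2⟩
      invFun := fun c => ⟨fun x => x.elim (c.1 a) c.1, hinv c.1 c.2⟩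
      left_inv := fun c => ?_
      right_inv := fun c => rfl } (Equiv.prodUnique _ _).symm)
  ext x
  cases x with
  | none => simpa using c.2 none
  | some x => rfl

theorem numCycles_decompose {α : Type} [Finite α] [DecidableEq α] (i : Option α) (σ : Perm α) :
    numCycles (swap none i * optionCongr σ) = numCycles σ + if i = none then 1 else 0 := by
  cases i with
  | none =>
    rw [swap_self, ← Perm.one_def, one_mul, if_pos rfl, numCycles_optionCongr]
  | some a => simpa using numCycles_swap_mul_optionCongr a σ

/-- The generating function `∑ᵤ P ^ κ(u) * Q ^ κ(u w)`. -/
noncomputable def factorizationSum {α : Type} [Fintype α] [DecidableEq α] (P Q : ℤ)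
    (w : Perm α) : ℤ :=
  ∑ u : Perm α, P ^ numCycles u * Q ^ numCycles (u * w)

theorem factorizationSum_permCongr {α β : Type} [Fintype α] [DecidableEq α] [Fintype β]
    [DecidableEq β] (P Q : ℤ) (e : α ≃ β) (w : Perm α) :
    factorizationSum P Q (e.permCongr w) = factorizationSum P Q w := by
  symm
  refine Fintype.sum_equiv e.permCongr _ _ fun u => ?_
  have h : e.permCongr u * e.permCongr w = e.permCongr (u * w) := by
    ext x
    simp [Equiv.permCongr_apply]
  rw [h, numCycles_permCongr, numCycles_permCongr]

theorem factorizationSum_option {α : Type} [Fintype α] [DecidableEq α] (P Q : ℤ)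
    (w : Perm (Option α)) :
    factorizationSum P Q w = ∑ i : Option α,
      P ^ (if i = none then 1 else 0) * Q ^ (if w i = none then 1 else 0) *
        factorizationSum P Q (removeNone (w * swap none i)) := by
  rw [factorizationSum, ← Fintype.sum_equiv Perm.decomposeOption.symm _ _ fun _ => rfl,
    Fintype.sum_prod_type]
  refine Finset.sum_congr rfl fun i _ => ?_
  rw [factorizationSum, Finset.mul_sum]
  refine Finset.sum_congr rfl fun σ _ => ?_
  have h1 : Perm.decomposeOption.symm (i, σ) = swap none i * optionCongr σ := rfl
  have h2 : numCycles (swap none i * optionCongr σ * w) =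
      numCycles (σ * removeNone (w * swap none i)) + if w i = none then 1 else 0 := by
    have h3 : w * swap none i =
        swap none (w i) * optionCongr (removeNone (w * swap none i)) := by
      simp
    have h4 : w * swap none i * optionCongr σ =
        swap none (w i) * optionCongr (removeNone (w * swap none i) * σ) := by
      conv_lhs => rw [h3, mul_assoc]
      congr 1
      refine Equiv.ext fun x => ?_
      cases x <;> rfl
    rw [numCycles_mul_comm, ← mul_assoc, h4, numCycles_decompose, numCycles_mul_comm σ]
  rw [h1, h2, numCycles_decompose, pow_add, pow_add]
  ring

theorem kappa_eq_numCycles {k : ℕ} (w : Perm (Fin k)) : kappa w = numCycles w := by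
  refine Nat.card_congr (Equiv.ofBijective
    (fun x => Quotient.mk (Perm.SameCycle.setoid w) x.1) ⟨fun x y h => ?_, fun c => ?_⟩)
  · have h' : w.SameCycle x.1 y.1 := Quotient.exact h
    exact Subtype.ext (le_antisymm (x.2 _ h') (y.2 _ h'.symm))
  · induction c using Quotient.ind with | _ x
    classical
    have hne : (Finset.univ.filter fun y => w.SameCycle x y).Nonempty :=
      ⟨x, by simp [Perm.SameCycle.refl]⟩
    have hmem := Finset.min'_mem _ hne
    rw [Finset.mem_filter] at hmem
    refine ⟨⟨_, fun y hy => Finset.min'_le _ y ?_⟩, Quotient.sound hmem.2.symm⟩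
    simpa using hmem.2.trans hy

/-- `∑ ∏ₓ X_{c x}` over the `w`-invariant colourings `c`, that is, the product of the power sums
indexed by the cycle lengths of `w`. -/
noncomputable def cyclePoly {α : Type} [Fintype α] [DecidableEq α] (p : ℕ) (w : Perm α) :
    MvPolynomial (Fin p) ℤ :=
  ∑ c : {c : α → Fin p // ∀ x, c (w x) = c x}, ∏ x, X (c.1 x)

theorem cyclePoly_permCongr {α β : Type} [Fintype α] [DecidableEq α] [Fintype β]
    [DecidableEq β] (p : ℕ) (e : α ≃ β) (w : Perm α) :
    cyclePoly p (e.permCongr w) = cyclePoly p w := by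
  symm
  refine Fintype.sum_equiv ((e.arrowCongr (Equiv.refl (Fin p))).subtypeEquiv fun c => ?_) _ _
    fun c => ?_
  · refine ⟨fun h x => ?_, fun h x => ?_⟩
    · simpa using h (e.symm x)
    · simpa using h (e x)
  · exact Fintype.prod_equiv e _ _ fun x => by
      change X (c.1 x) = X (c.1 (e.symm (e x)))
      rw [e.symm_apply_apply]

theorem sum_invariant_eq {α T A : Type} [Fintype α] [DecidableEq α] [Fintype T] [AddCommMonoid A]
    {p : ℕ} (v : Perm α) (Φ : T → α → Fin p) (hinj : Function.Injective Φ)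
    (hinv : ∀ t x, Φ t (v x) = Φ t x)
    (hsurj : ∀ d : α → Fin p, (∀ x, d (v x) = d x) → ∃ t, Φ t = d) (f : (α → Fin p) → A) :
    ∑ d : {d : α → Fin p // ∀ x, d (v x) = d x}, f d.1 = ∑ t, f (Φ t) := by
  symm
  refine Fintype.sum_bijective (fun t => ⟨Φ t, hinv t⟩)
    ⟨fun s t h => hinj (congrArg Subtype.val h), fun d => ?_⟩ _ _ fun _ => rfl
  obtain ⟨t, ht⟩ := hsurj d.1 d.2
  exact ⟨t, Subtype.ext ht⟩

/-- The sum over invariant colourings of `Option γ`, with the variable at `none` left out. -/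
noncomputable def punctured {γ : Type} [Fintype γ] [DecidableEq γ] (p : ℕ)
    (v : Perm (Option γ)) : MvPolynomial (Fin p) ℤ :=
  ∑ d : {d : Option γ → Fin p // ∀ x, d (v x) = d x}, ∏ x, X (d.1 (some x))

theorem punctured_of_ne {γ : Type} [Fintype γ] [DecidableEq γ] (p : ℕ) (v : Perm (Option γ))
    (hv : v none ≠ none) : punctured p v = cyclePoly p (removeNone v) := by
  obtain ⟨a, ha⟩ := Option.ne_none_iff_exists'.mp hv
  rw [punctured, sum_invariant_eq (T := {c : γ → Fin p // ∀ x, c (removeNone v x) = c x}) v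
    (fun c x => x.elim (c.1 a) c.1) _ _ _ (fun d => ∏ x, X (d (some x)))]
  · rfl
  · intro c c' h
    exact Subtype.ext (funext fun x => congrFun h (some x))
  · intro c x
    cases x with
    | none => rw [ha]; rfl
    | some x =>
      rcases hx : v (some x) with _ | y
      · have h := removeNone_none v hx
        rw [ha, Option.some_inj] at h
        rw [Option.elim_none, Option.elim_some, ← c.2 x, h]
      · have h := removeNone_some v ⟨y, hx⟩
        rw [← hx, ← h, Option.elim_some, Option.elim_some, c.2 x]
  · intro d hd
    refine ⟨⟨fun x => d (some x), fun x => ?_⟩, ?_⟩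
    · change d (some _) = d (some x)
      rcases hx : v (some x) with _ | y
      · rw [removeNone_none v hx, hd, ← hd (some x), hx]
      · rw [removeNone_some v ⟨y, hx⟩, hd]
    · ext1 x
      cases x with
      | none => exact (congrArg d ha).symm.trans (hd none)
      | some x => rfl

theorem punctured_of_eq {γ : Type} [Fintype γ] [DecidableEq γ] (p : ℕ) (v : Perm (Option γ))
    (hv : v none = none) : punctured p v = (p : ℤ) • cyclePoly p (removeNone v) := by
  have hs : ∀ x, some (removeNone v x) = v (some x) := fun x => by
    refine removeNone_some v (Option.ne_none_iff_exists'.mp fun hx => ?_)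
    exact Option.some_ne_none x (v.injective (hx.trans hv.symm))
  rw [punctured, sum_invariant_eq (T := Fin p × {c : γ → Fin p // ∀ x, c (removeNone v x) = c x})
    v (fun c x => x.elim c.1 c.2.1) _ _ _ (fun d => ∏ x, X (d (some x))), Fintype.sum_prod_type]
  · simp [cyclePoly]
  · intro c c' h
    exact Prod.ext (congrFun h none) (Subtype.ext (funext fun x => congrFun h (some x)))
  · intro c x
    cases x with
    | none => rw [hv]
    | some x => rw [← hs, Option.elim_some, Option.elim_some, c.2.2 x]
  · intro d hd
    refine ⟨⟨d none, fun x => d (some x), fun x => ?_⟩, ?_⟩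
    · change d (some _) = d (some x)
      rw [hs, hd]
    · ext1 x
      cases x <;> rfl

theorem removeNone_mul_swap {γ : Type} [DecidableEq γ] (w : Perm (Option γ)) {a : γ}
    (ha : w (some a) = none) : removeNone (w * swap none (some a)) = removeNone w := by
  have hn : w none ≠ none := fun h => Option.some_ne_none a (w.injective (ha.trans h.symm))
  ext x
  apply Option.some_injective
  rcases eq_or_ne x a with rfl | hx
  · have h : (w * swap none (some x) : Perm (Option γ)) (some x) = w none := by simp
    rw [removeNone_none w ha, removeNone_some _ (by rw [h]; exact Option.ne_none_iff_exists'.mp hn),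
      h]
  · have h : (w * swap none (some a) : Perm (Option γ)) (some x) = w (some x) := by
      rw [Perm.mul_apply, swap_apply_of_ne_of_ne (by simp) (by simpa using hx)]
    have h' : w (some x) ≠ none := fun h' =>
      hx (Option.some_injective _ (w.injective (h'.trans ha.symm)))
    rw [removeNone_some w (Option.ne_none_iff_exists'.mp h'),
      removeNone_some _ (by rw [h]; exact Option.ne_none_iff_exists'.mp h'), h]

/-- Separating the point `0` of `Fin (m + 1)`. -/
def splitZero (m : ℕ) (β : Type) : Fin (m + 1) ⊕ β ≃ Option (Fin m ⊕ β) where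
  toFun x := x.elim (Fin.cases none fun t => some (Sum.inl t)) fun b => some (Sum.inr b)
  invFun x := x.elim (Sum.inl 0) (Sum.map Fin.succ id)
  left_inv x := by
    rcases x with x | b
    · refine Fin.cases ?_ (fun t => ?_) x <;> rfl
    · rfl
  right_inv x := by
    rcases x with _ | x | b <;> rfl

/-- The disjoint union of the cycle `none, 0, 1, …, m - 1` and of the permutation `τ`. -/
def rotor {β : Type} (m : ℕ) (τ : Perm β) : Perm (Option (Fin m ⊕ β)) :=
  (splitZero m β).permCongr (Equiv.sumCongr (finRotate (m + 1)) τ)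

section rotor

variable {β : Type} {m : ℕ} (τ : Perm β)

theorem rotor_none (h : 0 < m) : rotor m τ none = some (Sum.inl ⟨0, h⟩) := by
  obtain ⟨n, rfl⟩ : ∃ n, m = n + 1 := ⟨m - 1, by omega⟩
  have h1 : finRotate (n + 1 + 1) 0 = Fin.succ ⟨0, h⟩ := by
    simp
  simp only [rotor, permCongr_apply]
  change splitZero _ β (Sum.inl (finRotate _ 0)) = _
  rw [h1]
  rfl

theorem rotor_none_zero (τ : Perm β) : rotor 0 τ none = none := rfl

theorem rotor_inl (t : ℕ) (ht : t < m) (h : t + 1 < m) :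
    rotor m τ (some (Sum.inl ⟨t, ht⟩)) = some (Sum.inl ⟨t + 1, h⟩) := by
  have h1 : finRotate (m + 1) (Fin.succ ⟨t, ht⟩) = Fin.succ ⟨t + 1, h⟩ :=
    finRotate_of_lt (k := t + 1) h
  simp only [rotor, permCongr_apply]
  change splitZero _ β (Sum.inl (finRotate _ (Fin.succ ⟨t, ht⟩))) = _
  rw [h1]
  rfl

theorem rotor_inl_last (t : ℕ) (ht : t < m) (h : t + 1 = m) :
    rotor m τ (some (Sum.inl ⟨t, ht⟩)) = none := by
  subst h
  have h1 : finRotate (t + 1 + 1) (Fin.succ ⟨t, ht⟩) = 0 :=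
    finRotate_last (n := t + 1)
  simp only [rotor, permCongr_apply]
  change splitZero _ β (Sum.inl (finRotate _ (Fin.succ ⟨t, ht⟩))) = _
  rw [h1]
  rfl

theorem rotor_inr (b : β) : rotor m τ (some (Sum.inr b)) = some (Sum.inr (τ b)) := rfl

theorem rotor_none_invariant {R : Type} {d : Option (Fin m ⊕ β) → R}
    (hd : ∀ x, d (rotor m τ x) = d x) (t : ℕ) (ht : t < m) :
    d (some (Sum.inl ⟨t, ht⟩)) = d none := by
  induction t with
  | zero => rw [← rotor_none τ ht, hd]
  | succ t ih => rw [← rotor_inl τ t (by omega) ht, hd, ih]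

theorem sum_rotor_invariant [Fintype β] [DecidableEq β] {A : Type} [AddCommMonoid A] {p : ℕ}
    (f : (Option (Fin m ⊕ β) → Fin p) → A) :
    ∑ d : {d : Option (Fin m ⊕ β) → Fin p // ∀ x, d (rotor m τ x) = d x}, f d.1 =
      ∑ i : Fin p, ∑ c : {c : β → Fin p // ∀ x, c (τ x) = c x},
        f fun x => x.elim i (Sum.elim (fun _ => i) c.1) := by
  rw [sum_invariant_eq (T := Fin p × {c : β → Fin p // ∀ x, c (τ x) = c x}) (rotor m τ)
    (fun c x => x.elim c.1 (Sum.elim (fun _ => c.1) c.2.1)) _ _ _ f, Fintype.sum_prod_type]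
  · intro c c' h
    exact Prod.ext (congrFun h none)
      (Subtype.ext (funext fun x => congrFun h (some (Sum.inr x))))
  · rintro ⟨i, c⟩ x
    rcases x with _ | ⟨t, ht⟩ | b
    · rcases Nat.eq_zero_or_pos m with rfl | h
      · rfl
      · rw [rotor_none τ h]; rfl
    · rcases (show t + 1 < m ∨ t + 1 = m by omega) with h | h
      · rw [rotor_inl τ t ht h]; rfl
      · rw [rotor_inl_last τ t ht h]; rfl
    · exact c.2 b
  · intro d hd
    refine ⟨⟨d none, fun b => d (some (Sum.inr b)), fun b => hd (some (Sum.inr b))⟩, ?_⟩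
    ext1 x
    rcases x with _ | ⟨t, ht⟩ | b
    · rfl
    · exact (rotor_none_invariant τ hd t ht).symm
    · rfl

theorem punctured_rotor [Fintype β] [DecidableEq β] (p : ℕ) :
    punctured p (rotor m τ) = psum p m * cyclePoly p τ := by
  rw [punctured, sum_rotor_invariant τ (fun d => ∏ x, X (d (some x))), psum, cyclePoly,
    Finset.sum_mul_sum]
  simp [Fintype.prod_sum_type]

theorem cyclePoly_rotor [Fintype β] [DecidableEq β] (p : ℕ) :
    cyclePoly p (rotor m τ) = psum p (m + 1) * cyclePoly p τ := by
  rw [cyclePoly, sum_rotor_invariant τ (fun d => ∏ x, X (d x)), psum, cyclePoly,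
    Finset.sum_mul_sum]
  simp [Fintype.prod_sum_type, Fintype.prod_option, pow_succ', mul_assoc]

theorem invariant_mul_swap {γ R : Type} [DecidableEq γ] (w : Perm γ) (x y : γ) (d : γ → R) :
    (∀ z, d ((w * swap x y) z) = d z) ↔ ∀ z, d (w z) = d (swap x y z) :=
  ⟨fun h z => by simpa using h (swap x y z), fun h z => by simpa using h (swap x y z)⟩

theorem punctured_rotor_inr [Fintype β] [DecidableEq β] (p : ℕ) (b : β) :
    punctured p (rotor m τ * swap none (some (Sum.inr b))) =
      ∑ c : {c : β → Fin p // ∀ x, c (τ x) = c x}, X (c.1 b) ^ m * ∏ x, X (c.1 x) := by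
  rw [punctured, sum_invariant_eq (T := {c : β → Fin p // ∀ x, c (τ x) = c x}) _
    (fun c x => x.elim (c.1 b) (Sum.elim (fun _ => c.1 b) c.1)) _ _ _
    (fun d => ∏ x, X (d (some x)))]
  · simp [Fintype.prod_sum_type]
  · intro c c' h
    exact Subtype.ext (funext fun x => congrFun h (some (Sum.inr x)))
  · intro c
    refine (invariant_mul_swap _ _ _
      (fun x : Option (Fin m ⊕ β) => x.elim (c.1 b) (Sum.elim (fun _ => c.1 b) c.1))).mpr fun x => ?_
    rcases x with _ | ⟨t, ht⟩ | b'
    · rw [swap_apply_left]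
      rcases Nat.eq_zero_or_pos m with rfl | h
      · rfl
      · rw [rotor_none τ h]; rfl
    · rw [swap_apply_of_ne_of_ne (by simp) (by simp)]
      rcases (show t + 1 < m ∨ t + 1 = m by omega) with h | h
      · rw [rotor_inl τ t ht h]; rfl
      · rw [rotor_inl_last τ t ht h]; rfl
    · rw [rotor_inr]
      rcases eq_or_ne b' b with rfl | hb
      · rw [swap_apply_right]
        exact c.2 b'
      · rw [swap_apply_of_ne_of_ne (by simp) (by simpa using hb)]
        exact c.2 b'
  · intro d hd
    rw [invariant_mul_swap] at hd
    have h0 := hd none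
    have hb := hd (some (Sum.inr b))
    rw [swap_apply_left] at h0
    rw [swap_apply_right, rotor_inr] at hb
    have hinl : ∀ t (ht : t < m), d (some (Sum.inl ⟨t, ht⟩)) = d (some (Sum.inr b)) := by
      intro t ht
      induction t with
      | zero => rw [← rotor_none τ ht, h0]
      | succ t ih =>
        rw [← rotor_inl τ t (by omega) ht, hd, swap_apply_of_ne_of_ne (by simp) (by simp), ih]
    have hnone : d none = d (some (Sum.inr b)) := by
      rcases Nat.eq_zero_or_pos m with rfl | h
      · exact h0
      · obtain ⟨n, rfl⟩ : ∃ n, m = n + 1 := ⟨m - 1, by omega⟩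
        have h1 := hd (some (Sum.inl ⟨n, Nat.lt_succ_self n⟩))
        rw [rotor_inl_last τ n _ rfl, swap_apply_of_ne_of_ne (by simp) (by simp), hinl] at h1
        exact h1
    refine ⟨⟨fun b => d (some (Sum.inr b)), fun b' => ?_⟩, ?_⟩
    · change d (some (Sum.inr (τ b'))) = d (some (Sum.inr b'))
      rcases eq_or_ne b' b with rfl | hb'
      · rw [hb, hnone]
      · have h1 := hd (some (Sum.inr b'))
        rwa [swap_apply_of_ne_of_ne (by simp) (by simpa using hb'), rotor_inr] at h1
    · ext1 x
      rcases x with _ | ⟨t, ht⟩ | b'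
      · exact hnone.symm
      · exact (hinl t ht).symm
      · rfl

theorem punctured_rotor_inl [Fintype β] [DecidableEq β] (p s : ℕ) (hs' : s < m) (hs : s + 1 < m) :
    punctured p (rotor m τ * swap none (some (Sum.inl ⟨s, hs'⟩))) =
      psum p (s + 1) * psum p (m - 1 - s) * cyclePoly p τ := by
  rw [punctured, sum_invariant_eq
    (T := (Fin p × Fin p) × {c : β → Fin p // ∀ x, c (τ x) = c x}) _
    (fun c x => x.elim c.1.2
      (Sum.elim (fun t => if t.1 ≤ s then c.1.1 else c.1.2) c.2.1)) _ _ _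
    (fun d => ∏ x, X (d (some x)))]
  · have hprod : ∀ i j : Fin p, ∏ t : Fin m, (X (if t.1 ≤ s then i else j) :
        MvPolynomial (Fin p) ℤ) = X i ^ (s + 1) * X j ^ (m - 1 - s) := fun i j => by
      rw [Fin.prod_univ_eq_prod_range (fun t => (X (if t ≤ s then i else j) :
        MvPolynomial (Fin p) ℤ)) m, ← Finset.prod_range_mul_prod_Ico _ hs'.nat_succ_le]
      congr 1
      · rw [Finset.prod_congr rfl fun t ht => by
          rw [if_pos (Nat.lt_succ_iff.mp (Finset.mem_range.mp ht))]]
        simp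
      · rw [Finset.prod_congr rfl fun t ht => by
          rw [if_neg (Nat.not_le.mpr (Finset.mem_Ico.mp ht).1)]]
        simp only [Finset.prod_const, Nat.card_Ico]
        congr 1
        omega
    rw [Fintype.sum_prod_type, Fintype.sum_prod_type, psum, psum, cyclePoly, Finset.sum_mul_sum,
      Finset.sum_mul]
    refine Finset.sum_congr rfl fun i _ => ?_
    rw [Finset.sum_mul_sum]
    refine Finset.sum_congr rfl fun j _ => Finset.sum_congr rfl fun c _ => ?_
    simp [Fintype.prod_sum_type, hprod]
  · rintro ⟨⟨i, j⟩, c⟩ ⟨⟨i', j'⟩, c'⟩ h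
    have h1 : j = j' := congrFun h none
    have h2 := congrFun h (some (Sum.inl ⟨0, by omega⟩))
    have h3 : c = c' := Subtype.ext (funext fun x => congrFun h (some (Sum.inr x)))
    simp at h2
    rw [h1, h2, h3]
  · rintro ⟨⟨i, j⟩, c⟩
    refine (invariant_mul_swap _ _ _ (fun x : Option (Fin m ⊕ β) => x.elim j
      (Sum.elim (fun t => if t.1 ≤ s then i else j) c.1))).mpr fun x => ?_
    rcases x with _ | ⟨t, ht⟩ | b
    · rw [swap_apply_left, rotor_none τ (by omega)]
      simp
    · rcases eq_or_ne t s with rfl | hts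
      · rw [swap_apply_right, rotor_inl τ t ht hs]
        simp
      · rw [swap_apply_of_ne_of_ne (by simp) (by simpa using hts)]
        rcases (show t + 1 < m ∨ t + 1 = m by omega) with h | h
        · rw [rotor_inl τ t ht h]
          have : t + 1 ≤ s ↔ t ≤ s := by omega
          simp [this]
        · rw [rotor_inl_last τ t ht h]
          have : ¬ t ≤ s := by omega
          simp [this]
    · rw [swap_apply_of_ne_of_ne (by simp) (by simp)]
      exact c.2 b
  · intro d hd
    rw [invariant_mul_swap] at hd
    have hm : 0 < m := by omega
    have h1 : ∀ t (ht : t < m), t ≤ s → d (some (Sum.inl ⟨t, ht⟩)) =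
        d (some (Sum.inl ⟨0, hm⟩)) := by
      intro t ht hts
      induction t with
      | zero => rfl
      | succ t ih =>
        rw [← rotor_inl τ t (by omega) ht, hd,
          swap_apply_of_ne_of_ne (by simp) (by simp; omega), ih _ (by omega)]
    have h2 : ∀ t (ht : t < m), s < t → d (some (Sum.inl ⟨t, ht⟩)) = d none := by
      intro t ht hts
      induction t with
      | zero => omega
      | succ t ih =>
        rw [← rotor_inl τ t (by omega) ht, hd]
        rcases eq_or_ne t s with rfl | hts'
        · rw [swap_apply_right]
        · rw [swap_apply_of_ne_of_ne (by simp) (by simpa using hts'), ih _ (by omega)]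
    refine ⟨⟨⟨d (some (Sum.inl ⟨0, hm⟩)), d none⟩, fun b => d (some (Sum.inr b)), fun b => ?_⟩, ?_⟩
    · have h := hd (some (Sum.inr b))
      rwa [swap_apply_of_ne_of_ne (by simp) (by simp), rotor_inr] at h
    · ext1 x
      rcases x with _ | ⟨t, ht⟩ | b
      · rfl
      · rcases le_or_gt t s with h | h
        · simp [h, h1 t ht h]
        · simp [h.not_ge, h2 t ht h]
      · rfl

theorem powDer_cyclePoly [Fintype β] [DecidableEq β] (p m : ℕ) :
    powDer p m (cyclePoly p τ) = ∑ b, ∑ c : {c : β → Fin p // ∀ x, c (τ x) = c x},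
      X (c.1 b) ^ m * ∏ x, X (c.1 x) := by
  rw [cyclePoly, map_sum, Finset.sum_comm]
  refine Finset.sum_congr rfl fun c _ => ?_
  rw [← Finset.sum_mul]
  exact derivation_prod_of_eigen _ _ _ _ fun b _ => by rw [powDer_X, pow_succ]

theorem cyclePoly_recursion [Fintype β] [DecidableEq β] (p : ℕ) (Q : ℤ) :
    ∑ i : Option (Fin m ⊕ β), ((p : ℤ) ^ (if i = none then 1 else 0) *
        Q ^ (if rotor m τ i = none then 1 else 0)) •
          cyclePoly p (removeNone (rotor m τ * swap none i)) =
      Q • (psum p m * cyclePoly p τ) +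
        ∑ s ∈ Finset.range m, psum p (s + 1) * psum p (m - 1 - s) * cyclePoly p τ +
        powDer p m (cyclePoly p τ) := by
  rw [Fintype.sum_option, Fintype.sum_sum_type, powDer_cyclePoly, ← add_assoc]
  congr 1
  · rw [swap_self, ← Perm.one_def, mul_one]
    rcases m with _ | m
    · rw [← punctured_rotor, punctured_of_eq _ _ (rotor_none_zero τ), rotor_none_zero]
      simp [mul_assoc, mul_left_comm]
    · have hne : rotor (m + 1) τ none ≠ none := by
        rw [rotor_none τ (Nat.succ_pos m)]
        simp
      have hlast : rotor (m + 1) τ (some (Sum.inl (Fin.last m))) = none :=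
        rotor_inl_last τ m (Nat.lt_succ_self m) rfl
      rw [Fin.sum_univ_castSucc, Finset.sum_range_succ, removeNone_mul_swap _ hlast,
        ← punctured_of_ne _ _ hne, punctured_rotor, Finset.sum_range]
      have hz : psum p 0 = (p : MvPolynomial (Fin p) ℤ) := by simp [psum]
      rw [if_pos rfl, if_neg hne, if_neg (by simp), if_pos hlast]
      have hterm : ∀ s : Fin m, ((p : ℤ) ^ (if some (Sum.inl (β := β) s.castSucc) = none
          then 1 else 0) * Q ^ (if rotor (m + 1) τ (some (Sum.inl s.castSucc)) = none
            then 1 else 0)) • cyclePoly p (removeNone (rotor (m + 1) τ *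
              swap none (some (Sum.inl s.castSucc)))) =
          psum p (s.1 + 1) * psum p (m + 1 - 1 - s.1) * cyclePoly p τ := fun s => by
        have hr := rotor_inl τ (m := m + 1) s.1 (by omega) (by omega)
        change rotor (m + 1) τ (some (Sum.inl s.castSucc)) = _ at hr
        rw [if_neg (by simp), if_neg (by rw [hr]; simp), ← punctured_of_ne,
          ← punctured_rotor_inl τ p s.1 (m := m + 1) (by omega) (by omega)]
        · rw [pow_zero, pow_zero, mul_one, one_smul]
          rfl
        · simp [hr]
      rw [Finset.sum_congr rfl fun s _ => hterm s]
      simp only [Nat.add_sub_cancel, Nat.sub_self, hz, zsmul_eq_mul]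
      push_cast
      ring
  · refine Finset.sum_congr rfl fun b _ => ?_
    rw [← punctured_rotor_inr, punctured_of_ne, if_neg (by simp), if_neg (by simp [rotor_inr])]
    · simp
    · simp [rotor_inr]

end rotor

theorem cycleType_permCongr {α β : Type} [Fintype α] [DecidableEq α] [Fintype β] [DecidableEq β]
    (e : α ≃ β) (w : Perm α) : (e.permCongr w).cycleType = w.cycleType := by
  let f : α ≃ {_b : β // True} := e.trans (Equiv.subtypeUnivEquiv fun _ => trivial).symm
  have h : e.permCongr w = w.extendDomain f := by
    ext x
    rw [Perm.extendDomain_apply_subtype _ _ trivial]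
    rfl
  rw [h, Perm.cycleType_extendDomain]

theorem cycleType_sumCongr {α β : Type} [Fintype α] [DecidableEq α] [Fintype β] [DecidableEq β]
    (σ : Perm α) (τ : Perm β) : Perm.cycleType (sumCongr σ τ) = σ.cycleType + τ.cycleType := by
  let f : α ≃ {x : α ⊕ β // x.isLeft = true} :=
    ⟨fun a => ⟨Sum.inl a, rfl⟩, fun x => x.1.getLeft x.2, fun _ => rfl, fun ⟨x, hx⟩ => by
      cases x <;> simp_all⟩
  let g : β ≃ {x : α ⊕ β // x.isRight = true} :=
    ⟨fun a => ⟨Sum.inr a, rfl⟩, fun x => x.1.getRight x.2, fun _ => rfl, fun ⟨x, hx⟩ => by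
      cases x <;> simp_all⟩
  have hσ : sumCongr σ 1 = σ.extendDomain f := by
    ext1 x
    rcases x with a | b
    · exact (Perm.extendDomain_apply_image σ f a).symm
    · exact (Perm.extendDomain_apply_not_subtype σ f (b := Sum.inr b) (by simp)).symm
  have hτ : sumCongr 1 τ = τ.extendDomain g := by
    ext1 x
    rcases x with a | b
    · exact (Perm.extendDomain_apply_not_subtype τ g (b := Sum.inl a) (by simp)).symm
    · exact (Perm.extendDomain_apply_image τ g b).symm
  have hd : Perm.Disjoint (sumCongr σ (1 : Perm β)) (sumCongr (1 : Perm α) τ) := by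
    rintro (a | b)
    · exact Or.inr rfl
    · exact Or.inl rfl
  have hm : sumCongr σ τ = sumCongr σ (1 : Perm β) * sumCongr (1 : Perm α) τ := by
    ext1 x
    cases x <;> rfl
  rw [hm, hd.cycleType_mul, hσ, hτ, Perm.cycleType_extendDomain, Perm.cycleType_extendDomain]

theorem cycleType_rotor {β : Type} [Fintype β] [DecidableEq β] (m : ℕ) (τ : Perm β) :
    (rotor m τ).cycleType = ({m + 1} : Multiset ℕ).filter (2 ≤ ·) + τ.cycleType := by
  rw [rotor, cycleType_permCongr, cycleType_sumCongr]
  rcases m with _ | m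
  · rw [Multiset.filter_singleton, if_neg (by norm_num)]
    simp [finRotate_one, ← Perm.one_def]
  · rw [Multiset.filter_singleton, if_pos (by omega), cycleType_finRotate]

theorem exists_permCongr_eq {α β : Type} [Fintype α] [DecidableEq α] [Fintype β] [DecidableEq β]
    (hcard : Fintype.card α = Fintype.card β) {w : Perm α} {v : Perm β}
    (h : w.cycleType = v.cycleType) : ∃ e : α ≃ β, e.permCongr w = v := by
  let f : α ≃ β := Fintype.equivOfCardEq hcard
  obtain ⟨c, hc⟩ := isConj_iff.mp
    (Perm.isConj_of_cycleType_eq ((cycleType_permCongr f w).trans h))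
  refine ⟨f.trans c, ?_⟩
  rw [← hc]
  ext x
  simp [permCongr_apply]

theorem exists_permCongr_eq_rotor {α : Type} [Fintype α] [DecidableEq α] {w : Perm α} {m : ℕ}
    {s : Multiset ℕ} (hcard : Fintype.card α = (m + 1) + s.sum)
    (hw : w.cycleType = ((m + 1) ::ₘ s).filter (2 ≤ ·)) :
    ∃ τ : Perm (Fin s.sum), τ.cycleType = s.filter (2 ≤ ·) ∧
      ∃ e : α ≃ Option (Fin m ⊕ Fin s.sum), e.permCongr w = rotor m τ := by
  obtain ⟨τ, hτ⟩ := (Perm.exists_with_cycleType_iff (Fin s.sum) (m := s.filter (2 ≤ ·))).mpr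
    ⟨by
      rw [Fintype.card_fin]
      conv_rhs => rw [← Multiset.filter_add_not (2 ≤ ·) s, Multiset.sum_add]
      exact Nat.le_add_right _ _, fun a ha => (Multiset.mem_filter.mp ha).2⟩
  refine ⟨τ, hτ, exists_permCongr_eq ?_ ?_⟩
  · rw [hcard, Fintype.card_option, Fintype.card_sum, Fintype.card_fin, Fintype.card_fin]
    omega
  · rw [hw, cycleType_rotor, hτ, ← Multiset.filter_add, Multiset.singleton_add]

theorem cyclePoly_eq_prod_psum (p : ℕ) (s : Multiset ℕ) : ∀ {α : Type} [Fintype α] [DecidableEq α]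
    {w : Perm α}, Fintype.card α = s.sum → w.cycleType = s.filter (2 ≤ ·) → (∀ a ∈ s, 0 < a) →
      cyclePoly p w = (s.map (psum p)).prod := by
  induction s using Multiset.induction with
  | empty =>
    intro α _ _ w hcard _ _
    have : IsEmpty α := Fintype.card_eq_zero_iff.mp hcard
    rw [cyclePoly, Finset.sum_congr rfl fun c _ => Finset.prod_of_isEmpty _]
    simp
  | cons a s ih =>
    intro α _ _ w hcard hw hpos
    obtain ⟨m, rfl⟩ : ∃ m, a = m + 1 :=
      ⟨a - 1, by have := hpos a (Multiset.mem_cons_self a s); omega⟩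
    rw [Multiset.sum_cons] at hcard
    obtain ⟨τ, hτ, e, he⟩ := exists_permCongr_eq_rotor hcard hw
    rw [← cyclePoly_permCongr p e, he, cyclePoly_rotor, Multiset.map_cons, Multiset.prod_cons,
      ih (Fintype.card_fin _) hτ fun b hb => hpos b (Multiset.mem_cons_of_mem hb)]

theorem fallFunctional_cyclePoly (p q : ℕ) (hp : 0 < p) (n : ℕ) :
    ∀ {α : Type} [Fintype α] [DecidableEq α] (w : Perm α), Fintype.card α = n →
      fallFunctional (fun _ : Fin p => q + p - 1) (vdm p ^ 2 * cyclePoly p w) =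
        (-1) ^ n * factorizationSum p (-q) w *
          fallFunctional (fun _ : Fin p => q + p - 1) (vdm p ^ 2) := by
  induction n with
  | zero =>
    intro α _ _ w hcard
    have hα : IsEmpty α := Fintype.card_eq_zero_iff.mp hcard
    have h1 : cyclePoly p w = 1 := by
      rw [cyclePoly, Finset.sum_congr rfl fun c _ => Finset.prod_of_isEmpty _]
      simp
    have h2 : factorizationSum p (-q) w = 1 := by
      have : ∀ u : Perm α, numCycles u = 0 := fun u => by
        rw [numCycles]
        have : IsEmpty (Quotient (Perm.SameCycle.setoid u)) := ⟨fun x => x.exists_rep.elim fun a _ => hα.elim a⟩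
        exact Nat.card_of_isEmpty
      simp [factorizationSum, this]
    rw [h1, h2]
    simp
  | succ n ih =>
    intro α _ _ w hcard
    have hα : Nonempty α := Fintype.card_pos_iff.mp (by omega)
    obtain ⟨a, ha⟩ : ∃ a, a ∈ w.partition.parts := by
      refine Multiset.exists_mem_of_ne_zero fun h => ?_
      have := w.partition.parts_sum
      rw [h, Multiset.sum_zero] at this
      omega
    obtain ⟨s, hs⟩ := Multiset.exists_cons_of_mem ha
    obtain ⟨m, rfl⟩ : ∃ m, a = m + 1 := ⟨a - 1, by have := w.partition.parts_pos ha; omega⟩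
    have hsum := w.partition.parts_sum
    rw [hs, Multiset.sum_cons] at hsum
    have hct := Perm.filter_parts_partition_eq_cycleType (σ := w)
    rw [hs] at hct
    obtain ⟨τ, -, e, he⟩ := exists_permCongr_eq_rotor hsum.symm hct.symm
    rw [← cyclePoly_permCongr p e, ← factorizationSum_permCongr _ _ e, he, cyclePoly_rotor,
      loop_equation p q m hp, factorizationSum_option]
    have hc : Fintype.card (Fin m ⊕ Fin s.sum) = n := by
      rw [Fintype.card_sum, Fintype.card_fin, Fintype.card_fin]
      omega
    have hrec := congrArg (fun f => fallFunctional (fun _ : Fin p => q + p - 1) (vdm p ^ 2 * f))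
      (cyclePoly_recursion τ (m := m) p (-q))
    simp only [Finset.mul_sum, mul_add, map_add, map_sum, mul_smul_comm, map_smul, ih _ hc] at hrec
    simp only [smul_eq_mul] at hrec
    rw [Finset.mul_sum, Finset.sum_mul]
    refine Eq.trans ?_ ((congrArg Neg.neg hrec.symm).trans ?_)
    · ring
    · rw [← Finset.sum_neg_distrib]
      exact Finset.sum_congr rfl fun i _ => by ring

theorem coeff_killCompl {σ τ : Type} {f : σ → τ} (hf : Function.Injective f)
    (φ : MvPolynomial τ ℤ) (a : σ →₀ ℕ) :
    coeff a (killCompl hf φ) = coeff (a.mapDomain f) φ := by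
  classical
  induction φ using MvPolynomial.induction_on' with
  | monomial b c =>
    by_cases hb : (b.support : Set τ) ⊆ Set.range f
    · obtain ⟨b, rfl⟩ : ∃ b', Finsupp.mapDomain f b' = b :=
        ⟨_, Finsupp.mapDomain_comapDomain f hf b hb⟩
      rw [killCompl_monomial_mapDomain, coeff_monomial, coeff_monomial]
      simp only [(Finsupp.mapDomain_injective hf).eq_iff]
    · rw [killCompl_monomial_eq_zero_of_not_subset hf c hb, coeff_zero, coeff_monomial, if_neg]
      rintro rfl
      refine hb ((Finset.coe_subset.mpr Finsupp.mapDomain_support).trans ?_)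
      simp
  | add φ ψ h1 h2 => rw [map_add, coeff_add, coeff_add, h1, h2]

/-- The polynomial ring in one more variable, with the last variable set to `0`. -/
noncomputable def dropLast (N : ℕ) : MvPolynomial (Fin (N + 1)) ℤ →ₐ[ℤ] MvPolynomial (Fin N) ℤ :=
  killCompl (Fin.castSucc_injective N)

theorem dropLast_X_castSucc {N : ℕ} (i : Fin N) : dropLast N (X i.castSucc) = X i := by
  have h := killCompl_rename_app (Fin.castSucc_injective N) (X i : MvPolynomial (Fin N) ℤ)
  rwa [rename_X] at h

theorem dropLast_X_last (N : ℕ) : dropLast N (X (Fin.last N)) = 0 :=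
  killCompl_monomial_eq_zero_of_notMem_range _ _ (a := Fin.last N) (by simp) (by simp)

theorem dropLast_psum (N r : ℕ) (hr : 0 < r) : dropLast N (psum (N + 1) r) = psum N r := by
  rw [psum, psum, Fin.sum_univ_castSucc]
  simp [dropLast_X_castSucc, dropLast_X_last, hr.ne']

theorem dropLast_vdm (N : ℕ) : dropLast N (vdm (N + 1)) = (∏ i, X i) * vdm N := by
  have hn (i : Fin N) : ¬ Fin.last N < i.castSucc := (Fin.castSucc_lt_last i).not_gt
  simp only [vdm, Finset.prod_filter, Fin.prod_univ_castSucc, map_mul, map_prod,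
    ← Finset.prod_mul_distrib, hn, lt_self_iff_false, if_false, Finset.prod_const_one,
    mul_one]
  refine Finset.prod_congr rfl fun i _ => ?_
  rw [if_pos (Fin.castSucc_lt_last i), map_sub, dropLast_X_last, sub_zero, dropLast_X_castSucc,
    mul_comm]
  congr 1
  refine Finset.prod_congr rfl fun j _ => ?_
  simp only [Fin.castSucc_lt_castSucc_iff, apply_ite (dropLast N), map_sub, map_one,
    dropLast_X_castSucc]

theorem coeff_one_add_prod_X_mul {N : ℕ} (a : Fin N → ℕ) (f : MvPolynomial (Fin N) ℤ) :
    coeff (Finsupp.equivFunOnFinite.symm fun i => a i + 1) ((∏ i, X i) * f) =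
      coeff (Finsupp.equivFunOnFinite.symm a) f := by
  have h : (∏ i, X i : MvPolynomial (Fin N) ℤ) =
      monomial (Finsupp.equivFunOnFinite.symm fun _ => 1) 1 := by
    rw [monomial_eq, Finsupp.prod_fintype _ _ (by simp)]
    simp
  have h' : (Finsupp.equivFunOnFinite.symm fun i => a i + 1) =
      Finsupp.equivFunOnFinite.symm (fun _ => 1) + Finsupp.equivFunOnFinite.symm a := by
    ext i
    simp [add_comm]
  rw [h, h', coeff_monomial_mul, one_mul]

/-- The exponents of the Frobenius formula in `N` variables for the `p × q` rectangle. -/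
noncomputable def rectExponent (p q N : ℕ) : Fin N →₀ ℕ :=
  Finsupp.equivFunOnFinite.symm fun i => (if i.1 < p then q else 0) + (N - 1 - i.1)

theorem coeff_rectExponent_succ (p q N : ℕ) (hN : p ≤ N) (s : Multiset ℕ) (hs : ∀ a ∈ s, 0 < a) :
    coeff (rectExponent p q (N + 1)) (vdm (N + 1) * (s.map (psum (N + 1))).prod) =
      coeff (rectExponent p q N) (vdm N * (s.map (psum N)).prod) := by
  have h : rectExponent p q (N + 1) = Finsupp.mapDomain Fin.castSucc
      (Finsupp.equivFunOnFinite.symm fun i => rectExponent p q N i + 1) := by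
    ext i
    refine Fin.lastCases ?_ (fun i => ?_) i
    · rw [Finsupp.mapDomain_of_notMem_range _ _ (by simp)]
      simp [rectExponent, hN]
    · rw [Finsupp.mapDomain_apply (Fin.castSucc_injective N)]
      simp [rectExponent]
      omega
  have h2 : dropLast N (s.map (psum (N + 1))).prod = (s.map (psum N)).prod := by
    rw [map_multiset_prod, Multiset.map_map]
    exact congrArg _ (Multiset.map_congr rfl fun a ha => dropLast_psum N a (hs a ha))
  rw [h, ← coeff_killCompl (Fin.castSucc_injective N)]
  change coeff _ (dropLast N _) = _
  rw [map_mul, dropLast_vdm, h2, mul_assoc, coeff_one_add_prod_X_mul]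
  simp

theorem coeff_rectExponent (p q N : ℕ) (hN : p ≤ N) (s : Multiset ℕ) (hs : ∀ a ∈ s, 0 < a) :
    coeff (rectExponent p q N) (vdm N * (s.map (psum N)).prod) =
      coeff (rectExponent p q p) (vdm p * (s.map (psum p)).prod) := by
  induction N, hN using Nat.le_induction with
  | base => rfl
  | succ N hN ih => rw [coeff_rectExponent_succ p q N hN s hs, ih]

theorem nthPart_rectangle (p q : ℕ) (hq : 0 < q) (i : ℕ) :
    nthPart (rectangle p q hq) i = if i < p then q else 0 := by
  have h : (rectangle p q hq).parts.sort (· ≤ ·) = List.replicate p q := by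
    refine List.eq_replicate_iff.mpr ⟨?_, fun b hb => ?_⟩
    · simp [rectangle]
    · rw [Multiset.mem_sort] at hb
      exact Multiset.eq_of_mem_replicate hb
  rw [nthPart, h, List.reverse_replicate, List.getD_eq_getElem?_getD, List.getElem?_replicate]
  split_ifs <;> rfl

theorem chi_rectangle (p q : ℕ) (hq : 0 < q) (mu : Nat.Partition (p * q)) :
    chi (p * q) (rectangle p q hq) mu =
      coeff (rectExponent p q p) (vdm p * (mu.parts.map (psum p)).prod) := by
  rw [← coeff_rectExponent p q (p * q) (Nat.le_mul_of_pos_right p hq) _ fun a ha =>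
    mu.parts_pos ha, chi, rectExponent]
  simp only [nthPart_rectangle]

theorem coeff_mul_psum_one_pow {p : ℕ} (e : Fin p →₀ ℕ) (d r : ℕ) (hd : d + r = ∑ i, e i)
    (h : MvPolynomial (Fin p) ℤ) (hh : h.IsHomogeneous d) :
    coeff e (h * psum p 1 ^ r) * ∏ i, ((e i).factorial : ℤ) = r.factorial * fallFunctional e h := by
  rw [← h.support_sum_monomial_coeff, Finset.sum_mul, coeff_sum, Finset.sum_mul, map_sum,
    Finset.mul_sum]
  refine Finset.sum_congr rfl fun a ha => ?_
  rw [coeff_monomial_mul', fallFunctional_monomial]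
  split_ifs with hae
  · have ha' : ∑ i, a i = d := by
      have := hh (mem_support_iff.mp ha)
      rw [Finsupp.weight_apply, Finsupp.sum_fintype _ _ (by simp)] at this
      simpa using this
    have hsum : ∑ i, (e - a) i = r := by
      have : ∑ i, (e - a) i + ∑ i, a i = ∑ i, e i := by
        rw [← Finset.sum_add_distrib]
        exact Finset.sum_congr rfl fun i _ => Nat.sub_add_cancel (hae i)
      omega
    have hm : (∏ i, ((e - a) i).factorial) * (e - a).multinomial = r.factorial := by
      rw [Finsupp.multinomial_eq_of_support_subset (Finset.subset_univ _),
        Nat.multinomial_spec, hsum]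
    have hfac : ∀ i, ((e i).factorial : ℤ) = ((e - a) i).factorial * (e i).descFactorial (a i) :=
      fun i => by
        rw [← Nat.factorial_mul_descFactorial (hae i)]
        push_cast
        rfl
    rw [show psum p 1 = ∑ i, X i by simp [psum], coeff_sum_X_pow_of_fintype,
      if_pos (by rwa [Finsupp.sum_fintype _ _ (by simp)]), Finset.prod_congr rfl fun i _ => hfac i,
      Finset.prod_mul_distrib, ← hm]
    push_cast
    ring
  · obtain ⟨i, hi⟩ : ∃ i, e i < a i := by
      by_contra! hc
      exact hae hc
    have h0 : ∏ i, ((e i).descFactorial (a i) : ℤ) = 0 := Finset.prod_eq_zero (Finset.mem_univ i)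
      (by rw [Nat.descFactorial_of_lt hi, Nat.cast_zero])
    rw [h0]
    simp

/-- The determinant of the Vandermonde matrix of the variables. -/
noncomputable def vandermondeDet (p : ℕ) : MvPolynomial (Fin p) ℤ :=
  (Matrix.vandermonde (X : Fin p → MvPolynomial (Fin p) ℤ)).det

/-- The exponent `(0, 1, …, p - 1)`. -/
noncomputable def staircase (p : ℕ) : Fin p →₀ ℕ := Finsupp.equivFunOnFinite.symm fun i => i.1

theorem monomial_staircase (p : ℕ) :
    (monomial (staircase p) 1 : MvPolynomial (Fin p) ℤ) = ∏ i, X i ^ i.1 := by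
  rw [monomial_eq, Finsupp.prod_fintype _ _ (by simp)]
  simp [staircase]

theorem vdm_eq_or (p : ℕ) : vdm p = vandermondeDet p ∨ vdm p = -vandermondeDet p := by
  have h : vdm p = (∏ i : Fin p, ∏ _j ∈ Finset.Ioi i, (-1)) * vandermondeDet p := by
    rw [vdm, vandermondeDet, Matrix.det_vandermonde, ← Finset.prod_mul_distrib]
    refine Finset.prod_congr rfl fun i _ => ?_
    rw [← Finset.prod_mul_distrib, Finset.filter_lt_eq_Ioi]
    exact Finset.prod_congr rfl fun j _ => by ring
  rw [h]
  simp only [Finset.prod_const, Finset.prod_pow_eq_pow_sum]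
  rcases neg_one_pow_eq_or (MvPolynomial (Fin p) ℤ) (∑ i : Fin p, (Finset.Ioi i).card) with h | h
  · left; rw [h, one_mul]
  · right; rw [h, neg_one_mul]

theorem vandermondeDet_eq_sum (p : ℕ) :
    vandermondeDet p =
      ∑ σ : Perm (Fin p), (Perm.sign σ : ℤ) • rename σ (monomial (staircase p) 1) := by
  rw [vandermondeDet, Matrix.det_apply]
  refine Finset.sum_congr rfl fun σ _ => ?_
  rw [monomial_staircase, map_prod, Units.smul_def]
  simp [Matrix.vandermonde_apply]

theorem rename_vandermondeDet {p : ℕ} (σ : Perm (Fin p)) :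
    rename σ (vandermondeDet p) = (Perm.sign σ : ℤ) • vandermondeDet p := by
  rw [vandermondeDet, AlgHom.map_det, zsmul_eq_mul, ← Matrix.det_permute]
  congr 1
  ext i j
  simp [Matrix.vandermonde_apply]

theorem rename_psum {p : ℕ} (σ : Perm (Fin p)) (r : ℕ) : rename σ (psum p r) = psum p r := by
  simp only [psum, map_sum, map_pow, rename_X]
  exact Equiv.sum_comp σ fun i => (X i : MvPolynomial (Fin p) ℤ) ^ r

theorem isHomogeneous_psum (p r : ℕ) : (psum p r).IsHomogeneous r :=
  IsHomogeneous.sum _ _ _ fun i _ => by simpa using (isHomogeneous_X ℤ i).pow r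

theorem isHomogeneous_prod_psum (p : ℕ) (s : Multiset ℕ) :
    (s.map (psum p)).prod.IsHomogeneous s.sum := by
  induction s using Multiset.induction_on with
  | empty => simpa using isHomogeneous_one _ _
  | cons a s ih => simpa using (isHomogeneous_psum p a).mul ih

theorem rename_prod_psum {p : ℕ} (σ : Perm (Fin p)) (s : Multiset ℕ) :
    rename σ (s.map (psum p)).prod = (s.map (psum p)).prod := by
  rw [map_multiset_prod, Multiset.map_map]
  exact congrArg _ (Multiset.map_congr rfl fun a _ => rename_psum σ a)

theorem isHomogeneous_vandermondeDet (p : ℕ) :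
    (vandermondeDet p).IsHomogeneous (∑ i : Fin p, i.1) := by
  rw [vandermondeDet_eq_sum]
  refine IsHomogeneous.sum _ _ _ fun σ _ => ?_
  rw [← C_mul', monomial_staircase]
  exact ((IsHomogeneous.prod _ _ _ fun i _ =>
    by simpa using (isHomogeneous_X ℤ i).pow i.1).rename_isHomogeneous).C_mul _

/-- The exponent with all entries equal to `M`. -/
noncomputable def constExponent (p M : ℕ) : Fin p →₀ ℕ :=
  Finsupp.equivFunOnFinite.symm fun _ => M

theorem coeff_constExponent_rename {p : ℕ} (M : ℕ) (σ : Perm (Fin p))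
    (f : MvPolynomial (Fin p) ℤ) :
    coeff (constExponent p M) (rename σ f) = coeff (constExponent p M) f := by
  rw [← coeff_rename_mapDomain σ σ.injective f]
  congr 1
  ext i
  obtain ⟨i, rfl⟩ := σ.surjective i
  rw [Finsupp.mapDomain_apply σ.injective]
  simp [constExponent]

theorem staircase_add_rectExponent (p q : ℕ) :
    constExponent p (q + p - 1) = staircase p + rectExponent p q p := by
  ext i
  simp [constExponent, staircase, rectExponent]
  omega

theorem coeff_vandermondeDet_mul (p q : ℕ) (g : MvPolynomial (Fin p) ℤ)
    (hg : ∀ σ : Perm (Fin p), rename σ g = g) :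
    (p.factorial : ℤ) * coeff (rectExponent p q p) (vandermondeDet p * g) =
      coeff (constExponent p (q + p - 1)) (vandermondeDet p ^ 2 * g) := by
  have h (σ : Perm (Fin p)) : coeff (constExponent p (q + p - 1))
      ((Perm.sign σ : ℤ) • rename σ (monomial (staircase p) 1) * (vandermondeDet p * g)) =
        coeff (rectExponent p q p) (vandermondeDet p * g) := by
    rw [smul_mul_assoc, ← mul_smul_comm, ← smul_mul_assoc, ← rename_vandermondeDet, ← hg σ,
      ← map_mul, ← map_mul, hg, coeff_constExponent_rename, staircase_add_rectExponent,
      coeff_monomial_mul, one_mul]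
  rw [pow_two, mul_assoc]
  conv_rhs => enter [2, 1]; rw [vandermondeDet_eq_sum]
  rw [Finset.sum_mul, coeff_sum, Finset.sum_congr rfl fun σ _ => h σ]
  simp [Fintype.card_perm]

theorem coeff_vdm_mul (p q : ℕ) : ∃ ε : ℤ, ∀ g : MvPolynomial (Fin p) ℤ,
    (∀ σ : Perm (Fin p), rename σ g = g) →
      (p.factorial : ℤ) * coeff (rectExponent p q p) (vdm p * g) =
        ε * coeff (constExponent p (q + p - 1)) (vdm p ^ 2 * g) := by
  rcases vdm_eq_or p with h | h
  · exact ⟨1, fun g hg => by rw [h, coeff_vandermondeDet_mul p q g hg, one_mul]⟩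
  · refine ⟨-1, fun g hg => ?_⟩
    rw [h, neg_sq, ← coeff_vandermondeDet_mul p q g hg, neg_mul, coeff_neg]
    ring

theorem fallFunctional_vandermondeDet_ne_zero {p : ℕ} (e : Fin p → ℕ)
    (he : Function.Injective e) : fallFunctional e (vandermondeDet p) ≠ 0 := by
  have h : fallFunctional e (vandermondeDet p) =
      (Matrix.vandermonde fun i => (e i : ℤ)).det := by
    rw [Matrix.det_eval_matrixOfPolynomials_eq_det_vandermonde _
      (fun i : Fin p => descPochhammer ℤ i) (fun i => descPochhammer_natDegree ℤ i)
      (fun i => monic_descPochhammer ℤ i), Matrix.det_apply, vandermondeDet_eq_sum, map_sum]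
    refine Finset.sum_congr rfl fun σ _ => ?_
    rw [map_smul, rename_monomial, fallFunctional_monomial, one_mul, Units.smul_def,
      ← Equiv.prod_comp σ]
    congr 1
    refine Finset.prod_congr rfl fun i _ => ?_
    rw [Finsupp.mapDomain_apply σ.injective, Matrix.of_apply,
      descPochhammer_eval_eq_descFactorial]
    rfl
  rw [h, Matrix.det_vandermonde_ne_zero_iff]
  exact Nat.cast_injective.comp he

theorem sum_rectExponent (p q : ℕ) :
    ∑ i, rectExponent p q p i = p * q + ∑ i : Fin p, i.1 := by
  have h : ∀ i : Fin p, rectExponent p q p i = q + (Fin.rev i).1 := fun i => by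
    simp [rectExponent, Fin.val_rev]
    omega
  have hrev : ∑ i : Fin p, (Fin.rev i).1 = ∑ i : Fin p, i.1 :=
    Equiv.sum_comp Fin.revPerm fun i : Fin p => i.1
  rw [Finset.sum_congr rfl fun i _ => h i, Finset.sum_add_distrib, hrev]
  simp

theorem coeff_vdm_mul_psum_one_pow_ne_zero (p q : ℕ) :
    coeff (rectExponent p q p) (vdm p * psum p 1 ^ (p * q)) ≠ 0 := by
  have h : coeff (rectExponent p q p) (vandermondeDet p * psum p 1 ^ (p * q)) ≠ 0 := fun h0 => by
    have h1 := coeff_mul_psum_one_pow (rectExponent p q p) _ (p * q)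
      (by rw [sum_rectExponent, add_comm]) _ (isHomogeneous_vandermondeDet p)
    rw [h0, zero_mul] at h1
    refine mul_ne_zero (Nat.cast_ne_zero.mpr (Nat.factorial_ne_zero _))
      (fallFunctional_vandermondeDet_ne_zero _ fun i j hij => ?_) h1.symm
    simp [rectExponent] at hij
    omega
  rcases vdm_eq_or p with h' | h' <;> rw [h']
  · exact h
  · rwa [neg_mul, coeff_neg, neg_ne_zero]

theorem isHomogeneous_vdm_sq (p : ℕ) : (vdm p ^ 2).IsHomogeneous (p * (p - 1)) := by
  have h : vdm p ^ 2 = vandermondeDet p ^ 2 := by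
    rcases vdm_eq_or p with h | h <;> rw [h]
    rw [neg_sq]
  rw [h, ← Finset.sum_range_id_mul_two, ← Fin.sum_univ_eq_sum_range fun i => i]
  exact (isHomogeneous_vandermondeDet p).pow 2

theorem coeff_vdm_sq_mul (p q : ℕ) (hp : 0 < p) (s : Multiset ℕ) (hs : s.sum ≤ p * q) :
    coeff (constExponent p (q + p - 1))
        (vdm p ^ 2 * ((s + Multiset.replicate (p * q - s.sum) 1).map (psum p)).prod) *
      ((q + p - 1).factorial : ℤ) ^ p =
    (p * q - s.sum).factorial *
      fallFunctional (fun _ => q + p - 1) (vdm p ^ 2 * (s.map (psum p)).prod) := by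
  have h := coeff_mul_psum_one_pow (constExponent p (q + p - 1)) (p * (p - 1) + s.sum)
    (p * q - s.sum) ?_ _ ((isHomogeneous_vdm_sq p).mul (isHomogeneous_prod_psum p s))
  · simpa [constExponent, mul_assoc] using h
  · obtain ⟨p, rfl⟩ := Nat.exists_eq_add_of_lt hp
    simp [constExponent]
    rw [add_assoc, Nat.add_sub_cancel' (by simpa using hs)]
    ring

/-- The rectangular character formula with denominators cleared. -/
theorem descFactorial_mul_coeff {α : Type} [Fintype α] [DecidableEq α] (p q : ℕ) (hp : 0 < p)
    (s : Multiset ℕ) (hpos : ∀ a ∈ s, 0 < a) (hs : s.sum ≤ p * q) (w : Perm α)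
    (hα : Fintype.card α = s.sum) (hw : w.cycleType = s.filter (2 ≤ ·)) :
    ((p * q).descFactorial s.sum : ℤ) * coeff (rectExponent p q p)
        (vdm p * ((s + Multiset.replicate (p * q - s.sum) 1).map (psum p)).prod) =
      (-1) ^ s.sum * factorizationSum p (-q) w *
        coeff (rectExponent p q p) (vdm p * psum p 1 ^ (p * q)) := by
  obtain ⟨ε, hε⟩ := coeff_vdm_mul p q
  have h1 := hε _ fun σ => rename_prod_psum σ (s + Multiset.replicate (p * q - s.sum) 1)
  have h2 := hε _ fun σ => rename_prod_psum σ (Multiset.replicate (p * q) 1)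
  have h3 := coeff_vdm_sq_mul p q hp s hs
  have h4 := coeff_vdm_sq_mul p q hp 0 (by simp)
  rw [← cyclePoly_eq_prod_psum p s hα hw hpos, fallFunctional_cyclePoly p q hp _ w hα] at h3
  simp only [Multiset.sum_zero, Nat.sub_zero, zero_add, Multiset.map_zero, Multiset.prod_zero,
    mul_one] at h4
  have h5 : ((p * q - s.sum).factorial : ℤ) * (p * q).descFactorial s.sum =
      (p * q).factorial := by exact_mod_cast Nat.factorial_mul_descFactorial hs
  simp only [Multiset.map_replicate, Multiset.prod_replicate] at h2 h4
  have hc : (p.factorial : ℤ) * ((q + p - 1).factorial : ℤ) ^ p ≠ 0 := by positivity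
  refine mul_left_cancel₀ hc ?_
  linear_combination ((q + p - 1).factorial : ℤ) ^ p * (p * q).descFactorial s.sum * h1
    + ε * (p * q).descFactorial s.sum * h3
    - (-1) ^ s.sum * factorizationSum p (-q) w * ((q + p - 1).factorial : ℤ) ^ p * h2
    - (-1) ^ s.sum * factorizationSum p (-q) w * ε * h4
    + (-1) ^ s.sum * factorizationSum p (-q) w * ε *
      fallFunctional (fun _ : Fin p => q + p - 1) (vdm p ^ 2) * h5

end RectangleCharacter

/-- Theorem 1. For `λ = p × q` a rectangle, `μ ⊢ k` and `w_μ ∈ S_k`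
of cycle type `μ`, the normalized character satisfies
`F_μ(p;q) = (-1)^k ∑_{u w_μ = v} p^{κ(u)} (-q)^{κ(v)}`, the sum over all `k!` pairs
`(u, v) ∈ S_k × S_k` with `u w_μ = v` (i.e. `v = u w_μ` as `u` ranges over `S_k`). -/
theorem stmt2 (k p q : ℕ) (hk : 1 ≤ k) (hp : 0 < p) (hq : 0 < q)
    (hkn : k ≤ p * q) (mu : Nat.Partition k) (w : Equiv.Perm (Fin k))
    (hw : w.cycleType = mu.parts.filter (fun a => 2 ≤ a)) :
    chihat (p * q) hkn (rectangle p q hq) mu =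
      (-1 : ℚ) ^ k *
        ∑ u : Equiv.Perm (Fin k), (p : ℚ) ^ kappa u * (-(q : ℚ)) ^ kappa (u * w) := by
  classical
  have hsum := mu.parts_sum
  have h := RectangleCharacter.descFactorial_mul_coeff p q hp mu.parts (fun a ha => mu.parts_pos ha)
    (by rwa [hsum]) w (by rw [hsum, Fintype.card_fin]) (by convert hw)
  have h0 := RectangleCharacter.coeff_vdm_mul_psum_one_pow_ne_zero p q
  rw [hsum] at h
  have h1 : chi (p * q) (rectangle p q hq) (onesPartition (p * q)) = MvPolynomial.coeff
      (RectangleCharacter.rectExponent p q p) (vdm p * psum p 1 ^ (p * q)) := by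
    rw [RectangleCharacter.chi_rectangle, onesPartition, Multiset.map_replicate,
      Multiset.prod_replicate]
  rw [chihat, h1, RectangleCharacter.chi_rectangle, div_eq_iff (Int.cast_ne_zero.mpr h0)]
  have h2 := congrArg (Int.cast : ℤ → ℚ) h
  simp only [RectangleCharacter.factorizationSum, ← RectangleCharacter.kappa_eq_numCycles] at h2
  push_cast at h2
  exact h2
end

section
/- Let λ be the partition of n whose Young diagram is a union of m rectangles of sizes p_i × q_i (i = 1,…,m) with q_1 ≥ q_2 ≥ ⋯ ≥ q_m, fix k ≥ 1 with k ≤ n, and let F_k(p_1,…,p_m; q_1,…,q_m) = χ̂^λ((k),1^{n-k}) be the normalized character at a single k-cycle. Then F_k(p;q) = −(1/k) [x^{−1}] ( (x)_k · Π_{i=1}^m (x − (q_i + p_i + p_{i+1} + ⋯ + p_m))_k ) / ( Π_{i=1}^m (x − (q_i + p_{i+1} + p_{i+2} + ⋯ + p_m))_k ), where (x)_k = x(x−1)⋯(x−k+1) and [x^{−1}] f(x) denotes the coefficient of x^{−1} in the expansion of f(x) in descending powers of x (i.e., in its Laurent expansion at x = ∞). -/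
open Equiv Finset

/-- The partition of `k ≥ 1` with the single part `k`. -/
def singlePart (k : ℕ) (hk : 1 ≤ k) : Nat.Partition k where
  parts := {k}
  parts_pos := by
    intro i hi
    rw [Multiset.mem_singleton.mp hi]
    exact hk
  parts_sum := by simp

/-- The falling-factorial polynomial `(x - c)_k = (x-c)(x-c-1)⋯(x-c-k+1)`. -/
noncomputable def fallPoly (c : ℚ) (k : ℕ) : Polynomial ℚ :=
  ∏ j ∈ Finset.range k, (Polynomial.X - Polynomial.C (c + j))

/-- The element `x = t⁻¹` of the field of formal Laurent series in `t`; expanding a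
rational function of `x` in descending powers of `x` means expanding it as a Laurent
series in `t = 1/x`, and `[x^{-1}]` is the coefficient of `t¹`. -/
noncomputable def xInfty : LaurentSeries ℚ := HahnSeries.single (-1 : ℤ) (1 : ℚ)

open MvPolynomial in
theorem coeff_sum_X_pow_mul_factorial {N : ℕ} (M : ℕ) (b : Fin N →₀ ℕ) (hb : ∑ i, b i = M) :
    coeff b ((∑ i : Fin N, X i : MvPolynomial (Fin N) ℤ) ^ M) * ∏ i, ((b i).factorial : ℤ) =
      M.factorial := by
  rw [Finset.sum_pow_eq_sum_piAntidiag, coeff_sum, Finset.sum_eq_single (b : Fin N → ℕ)]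
  · have h1 : (∏ i, X i ^ b i : MvPolynomial (Fin N) ℤ) = monomial b 1 := by
      rw [monomial_eq, Finsupp.prod_fintype] <;> simp
    rw [h1, ← C_eq_coe_nat, coeff_C_mul, coeff_monomial, if_pos rfl, mul_one, mul_comm]
    have := Nat.multinomial_spec univ b
    rw [hb] at this
    exact_mod_cast this
  · intro c hc hcb
    have h1 : (∏ i, X i ^ c i : MvPolynomial (Fin N) ℤ) =
        monomial (Finsupp.equivFunOnFinite.symm c) 1 := by
      rw [monomial_eq, Finsupp.prod_fintype] <;> simp
    rw [h1, ← C_eq_coe_nat, coeff_C_mul, coeff_monomial, if_neg, mul_zero]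
    rintro rfl
    exact hcb rfl
  · intro h
    exact absurd (by simp [hb]) h

open MvPolynomial in
theorem coeff_monomial_mul_sum_X_pow {N : ℕ} (M : ℕ) (a e : Fin N →₀ ℕ)
    (hM : ∑ i, a i = M + ∑ i, e i) :
    coeff a (monomial e 1 * (∑ i : Fin N, X i : MvPolynomial (Fin N) ℤ) ^ M) *
        ∏ i, ((a i).factorial : ℤ) =
      M.factorial * ∏ i, ((a i).descFactorial (e i) : ℤ) := by
  rw [coeff_monomial_mul']
  split_ifs with h
  · have h1 : ∏ i, ((a i).factorial : ℤ) =
        (∏ i, (((a - e) i).factorial : ℤ)) * ∏ i, ((a i).descFactorial (e i) : ℤ) := by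
      rw [← Finset.prod_mul_distrib]
      refine Finset.prod_congr rfl fun i _ => ?_
      rw [Finsupp.tsub_apply]
      exact_mod_cast (Nat.factorial_mul_descFactorial (h i)).symm
    have h2 : ∑ i, (a - e) i = M := by
      have : ∑ i, (a - e) i + ∑ i, e i = ∑ i, a i := by
        rw [← Finset.sum_add_distrib]
        refine Finset.sum_congr rfl fun i _ => ?_
        rw [Finsupp.tsub_apply, Nat.sub_add_cancel (h i)]
      omega
    rw [h1, one_mul, ← mul_assoc, coeff_sum_X_pow_mul_factorial M _ h2]
  · have : ∃ i, a i < e i := by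
      by_contra! hc
      exact h hc
    obtain ⟨i, hi⟩ := this
    rw [Finset.prod_eq_zero (f := fun i => ((a i).descFactorial (e i) : ℤ)) (Finset.mem_univ i)]
    · simp
    · exact_mod_cast Nat.descFactorial_of_lt hi

theorem det_vandermonde_eq_sum_descFactorial {N : ℕ} (a : Fin N → ℕ) :
    (Matrix.vandermonde fun i => (a i : ℤ)).det =
      ∑ σ : Perm (Fin N), (Perm.sign σ : ℤ) * ∏ i, ((a (σ i)).descFactorial i : ℤ) := by
  rw [Matrix.det_eval_matrixOfPolynomials_eq_det_vandermonde _
    (fun i => descPochhammer ℤ i) (fun i => descPochhammer_natDegree ℤ i)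
    (fun i => monic_descPochhammer ℤ i), Matrix.det_apply]
  simp [descPochhammer_eval_eq_descFactorial, Units.smul_def]

open MvPolynomial in
theorem coeff_det_vandermonde_mul_sum_X_pow {N : ℕ} (M : ℕ) (a : Fin N →₀ ℕ)
    (hM : ∑ i, a i = M + ∑ i : Fin N, (i : ℕ)) :
    coeff a ((Matrix.vandermonde (X : Fin N → MvPolynomial (Fin N) ℤ)).det *
        (∑ i : Fin N, X i) ^ M) * ∏ i, ((a i).factorial : ℤ) =
      M.factorial * (Matrix.vandermonde fun i => (a i : ℤ)).det := by
  rw [det_vandermonde_eq_sum_descFactorial, Matrix.det_apply, Finset.sum_mul, coeff_sum,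
    Finset.sum_mul, Finset.mul_sum]
  refine Finset.sum_congr rfl fun σ _ => ?_
  set e : Fin N →₀ ℕ := Finsupp.equivFunOnFinite.symm fun j => (σ⁻¹ j : ℕ) with he
  have h1 : (∏ i, Matrix.vandermonde X (σ i) i : MvPolynomial (Fin N) ℤ) = monomial e 1 := by
    rw [monomial_eq, Finsupp.prod_fintype _ _ (by simp)]
    simp only [Matrix.vandermonde_apply, C_1, one_mul]
    rw [← Equiv.prod_comp σ (fun j => (X j : MvPolynomial (Fin N) ℤ) ^ e j)]
    simp [he]
  have h2 : ∑ i, e i = ∑ i : Fin N, (i : ℕ) := by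
    simp only [he, Finsupp.equivFunOnFinite_symm_apply_apply]
    exact Equiv.sum_comp σ⁻¹ (fun i : Fin N => (i : ℕ))
  have h3 := coeff_monomial_mul_sum_X_pow M a e (by rw [hM, h2])
  have h4 : ∏ i, ((a i).descFactorial (e i) : ℤ) = ∏ i, ((a (σ i)).descFactorial i : ℤ) := by
    rw [← Equiv.prod_comp σ]
    simp [he]
  rw [h1, Units.smul_def, smul_mul_assoc, coeff_smul, smul_eq_mul, mul_assoc, h3, h4]
  ring

theorem exists_vdm_eq_mul_det_vandermonde (n : ℕ) :
    ∃ ε : ℤ, ε ≠ 0 ∧ vdm n = MvPolynomial.C ε *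
      (Matrix.vandermonde (MvPolynomial.X : Fin n → MvPolynomial (Fin n) ℤ)).det := by
  refine ⟨∏ i : Fin n, ∏ j ∈ Finset.univ.filter (fun j => i < j), (-1), ?_, ?_⟩
  · simp [Finset.prod_eq_zero_iff]
  · rw [Matrix.det_vandermonde, vdm]
    simp only [map_prod, ← Finset.prod_mul_distrib]
    refine Finset.prod_congr rfl fun i _ => ?_
    have : Finset.Ioi i = Finset.univ.filter (fun j => i < j) := by ext; simp
    rw [this, ← Finset.prod_mul_distrib]
    refine Finset.prod_congr rfl fun j _ => ?_
    simp

theorem prod_pairs_eq_mul_prod_erase {N : ℕ} (g : Fin N → Fin N → ℚ) (i : Fin N)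
    (hg : g i i = 1) :
    ∏ a, ∏ b, g a b = (∏ b ∈ univ.erase i, g i b * g b i) *
      ∏ a ∈ univ.erase i, ∏ b ∈ univ.erase i, g a b := by
  have h (a : Fin N) : ∏ b, g a b = g a i * ∏ b ∈ univ.erase i, g a b :=
    (Finset.mul_prod_erase univ _ (mem_univ i)).symm
  rw [← Finset.mul_prod_erase univ _ (mem_univ i), h i, hg, one_mul]
  simp only [h, Finset.prod_mul_distrib, mul_assoc]

theorem det_vandermonde_update_mul {N : ℕ} (v : Fin N → ℚ) (i : Fin N) (w : ℚ) :
    (Matrix.vandermonde (Function.update v i w)).det * ∏ j ∈ univ.erase i, (v i - v j) =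
      (Matrix.vandermonde v).det * ∏ j ∈ univ.erase i, (w - v j) := by
  have key (u : Fin N → ℚ) : (Matrix.vandermonde u).det =
      (∏ b ∈ univ.erase i, (if i < b then -1 else 1)) * (∏ b ∈ univ.erase i, (u i - u b)) *
      ∏ a ∈ univ.erase i, ∏ b ∈ univ.erase i, if a < b then u b - u a else 1 := by
    have h1 : (Matrix.vandermonde u).det = ∏ a, ∏ b, if a < b then u b - u a else 1 := by
      rw [Matrix.det_vandermonde]
      refine Finset.prod_congr rfl fun a _ => ?_
      rw [Finset.prod_ite, Finset.prod_const_one, mul_one]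
      refine Finset.prod_congr (by ext; simp) fun _ _ => rfl
    rw [h1, prod_pairs_eq_mul_prod_erase (fun a b => if a < b then u b - u a else 1) i (by simp)]
    congr 1
    rw [← Finset.prod_mul_distrib]
    refine Finset.prod_congr rfl fun b hb => ?_
    have hb' : b ≠ i := Finset.ne_of_mem_erase hb
    rcases lt_or_gt_of_ne hb' with h | h
    · simp [h, h.not_gt]
    · simp [h, h.not_gt]
  rw [key v, key (Function.update v i w)]
  have h2 : ∏ a ∈ univ.erase i, ∏ b ∈ univ.erase i,
      (if a < b then Function.update v i w b - Function.update v i w a else 1) =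
      ∏ a ∈ univ.erase i, ∏ b ∈ univ.erase i, if a < b then v b - v a else 1 := by
    refine Finset.prod_congr rfl fun a ha => Finset.prod_congr rfl fun b hb => ?_
    rw [Function.update_of_ne (Finset.ne_of_mem_erase ha),
      Function.update_of_ne (Finset.ne_of_mem_erase hb)]
  have h3 : ∏ b ∈ univ.erase i, (Function.update v i w i - Function.update v i w b) =
      ∏ b ∈ univ.erase i, (w - v b) := by
    refine Finset.prod_congr rfl fun b hb => ?_
    rw [Function.update_of_ne (Finset.ne_of_mem_erase hb), Function.update_self]
  rw [h2, h3]
  ring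

open MvPolynomial in
theorem coeff_X_pow_mul_det_vandermonde_mul {N : ℕ} (M k : ℕ) (i : Fin N) (a : Fin N →₀ ℕ)
    (hM : ∑ i, a i = M + k + ∑ i : Fin N, (i : ℕ)) :
    coeff a (X i ^ k * ((Matrix.vandermonde (X : Fin N → MvPolynomial (Fin N) ℤ)).det *
        (∑ i : Fin N, X i) ^ M)) * ∏ i, ((a i).factorial : ℤ) =
      M.factorial * ((a i).descFactorial k *
        (Matrix.vandermonde (Function.update (fun j => (a j : ℤ)) i (a i - k))).det) := by
  rw [X_pow_eq_monomial, coeff_monomial_mul']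
  by_cases h : k ≤ a i
  · have hle : Finsupp.single i k ≤ a := by
      rw [Finsupp.single_le_iff]
      exact h
    rw [if_pos hle, one_mul]
    set b := a - Finsupp.single i k with hb
    have hbi : b i = a i - k := by simp [hb]
    have hbj (j : Fin N) (hj : j ≠ i) : b j = a j := by simp [hb, hj.symm]
    have h1 : (fun j => (b j : ℤ)) = Function.update (fun j => (a j : ℤ)) i (a i - k) := by
      ext j
      rcases eq_or_ne j i with rfl | hj
      · rw [Function.update_self, hbi, Nat.cast_sub h]
      · rw [Function.update_of_ne hj, hbj j hj]
    have h2 : ∏ j, ((a j).factorial : ℤ) =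
        (∏ j, ((b j).factorial : ℤ)) * (a i).descFactorial k := by
      rw [← Finset.mul_prod_erase univ _ (mem_univ i),
        ← Finset.mul_prod_erase univ (fun j => ((b j).factorial : ℤ)) (mem_univ i), hbi,
        ← Nat.factorial_mul_descFactorial h,
        Finset.prod_congr rfl fun j hj => by rw [← hbj j (Finset.ne_of_mem_erase hj)]]
      push_cast
      ring
    have h3 : ∑ j, b j = M + ∑ j : Fin N, (j : ℕ) := by
      have h4 : ∑ j, a j = ∑ j, b j + k := by
        have h5 : ∑ j ∈ univ.erase i, a j = ∑ j ∈ univ.erase i, b j :=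
          Finset.sum_congr rfl fun j hj => (hbj j (Finset.ne_of_mem_erase hj)).symm
        rw [← Finset.add_sum_erase univ a (mem_univ i),
          ← Finset.add_sum_erase univ b (mem_univ i), hbi, h5]
        omega
      omega
    rw [h2, ← h1, ← mul_assoc, coeff_det_vandermonde_mul_sum_X_pow M b h3]
    ring
  · rw [if_neg, Nat.descFactorial_of_lt (not_le.mp h)]
    · simp
    · rw [Finsupp.single_le_iff]
      exact h

theorem chi_onesPartition_mul {n : ℕ} {lam : n.Partition} {l : Fin n → ℕ}
    (hl : ∀ i : Fin n, nthPart lam i + (n - 1 - i) = l i)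
    (hsum : ∑ i, l i = n + ∑ i : Fin n, (i : ℕ)) {ε : ℤ}
    (hε : vdm n = MvPolynomial.C ε *
      (Matrix.vandermonde (MvPolynomial.X : Fin n → MvPolynomial (Fin n) ℤ)).det) :
    chi n lam (onesPartition n) * ∏ i, ((l i).factorial : ℤ) =
      ε * n.factorial * (Matrix.vandermonde fun i => (l i : ℤ)).det := by
  have h := coeff_det_vandermonde_mul_sum_X_pow n (Finsupp.equivFunOnFinite.symm l) hsum
  simp only [Finsupp.equivFunOnFinite_symm_apply_apply] at h
  simp only [chi, hl, hε, onesPartition, Multiset.map_replicate, Multiset.prod_replicate, psum,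
    pow_one]
  rw [mul_assoc, MvPolynomial.coeff_C_mul, mul_assoc, h, mul_assoc]

theorem chi_padOnes_singlePart_mul {n k : ℕ} (hk : 1 ≤ k) (hkn : k ≤ n) {lam : n.Partition}
    {l : Fin n → ℕ} (hl : ∀ i : Fin n, nthPart lam i + (n - 1 - i) = l i)
    (hsum : ∑ i, l i = n + ∑ i : Fin n, (i : ℕ)) {ε : ℤ}
    (hε : vdm n = MvPolynomial.C ε *
      (Matrix.vandermonde (MvPolynomial.X : Fin n → MvPolynomial (Fin n) ℤ)).det) :
    chi n lam (padOnes n hkn (singlePart k hk)) * ∏ i, ((l i).factorial : ℤ) =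
      ε * (n - k).factorial * ∑ i, ((l i).descFactorial k *
        (Matrix.vandermonde (Function.update (fun j => (l j : ℤ)) i (l i - k))).det) := by
  have h (i : Fin n) := coeff_X_pow_mul_det_vandermonde_mul (n - k) k i
    (Finsupp.equivFunOnFinite.symm l) (by
      rw [Nat.sub_add_cancel hkn]
      exact hsum)
  simp only [Finsupp.equivFunOnFinite_symm_apply_apply] at h
  simp only [chi, hl, hε, padOnes, singlePart, Multiset.map_add, Multiset.map_singleton,
    Multiset.prod_add, Multiset.prod_singleton, Multiset.map_replicate, Multiset.prod_replicate]
  have h1 : psum n 1 = ∑ i, MvPolynomial.X i := by simp [psum]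
  rw [h1, psum, mul_assoc, MvPolynomial.coeff_C_mul, Finset.sum_mul, Finset.mul_sum,
    MvPolynomial.coeff_sum, mul_assoc, mul_assoc, Finset.sum_mul,
    Finset.mul_sum (a := ((n - k).factorial : ℤ))]
  congr 1
  refine Finset.sum_congr rfl fun i _ => ?_
  rw [← h i, mul_left_comm]

theorem cast_det_vandermonde {n : ℕ} (v : Fin n → ℤ) :
    ((Matrix.vandermonde v).det : ℚ) = (Matrix.vandermonde fun i => (v i : ℚ)).det := by
  simp [Matrix.det_vandermonde]

theorem chihat_singlePart_eq_sum {n k : ℕ} (hk : 1 ≤ k) (hkn : k ≤ n) {lam : n.Partition}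
    {l : Fin n → ℕ} (hl : ∀ i : Fin n, nthPart lam i + (n - 1 - i) = l i)
    (hsum : ∑ i, l i = n + ∑ i : Fin n, (i : ℕ)) (hinj : Function.Injective l) :
    chihat n hkn lam (singlePart k hk) = ∑ i, ((l i).descFactorial k : ℚ) *
      ∏ j ∈ univ.erase i, (((l i : ℚ) - k - l j) / (l i - l j)) := by
  obtain ⟨ε, hε0, hε⟩ := exists_vdm_eq_mul_det_vandermonde n
  have h1 := congrArg (Int.cast : ℤ → ℚ) (chi_onesPartition_mul hl hsum hε)
  have h2 := congrArg (Int.cast : ℤ → ℚ) (chi_padOnes_singlePart_mul hk hkn hl hsum hε)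
  simp only [Int.cast_mul, Int.cast_sum, Int.cast_prod, Int.cast_natCast,
    cast_det_vandermonde] at h1 h2
  have hF : (∏ i, ((l i).factorial : ℚ)) ≠ 0 :=
    Finset.prod_ne_zero_iff.mpr fun i _ => by positivity
  have hD : (Matrix.vandermonde fun i => (l i : ℚ)).det ≠ 0 :=
    Matrix.det_vandermonde_ne_zero_iff.mpr (Nat.cast_injective.comp hinj)
  have hε0' : (ε : ℚ) ≠ 0 := by exact_mod_cast hε0
  have hn : (n.factorial : ℚ) ≠ 0 := by positivity
  have hnk : ((n - k).factorial : ℚ) * n.descFactorial k = n.factorial := by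
    exact_mod_cast Nat.factorial_mul_descFactorial hkn
  have hterm (i : Fin n) :
      (Matrix.vandermonde fun j =>
        ((Function.update (fun j => (l j : ℤ)) i (l i - k) j : ℤ) : ℚ)).det =
      (Matrix.vandermonde fun i => (l i : ℚ)).det *
        ∏ j ∈ univ.erase i, (((l i : ℚ) - k - l j) / (l i - l j)) := by
    have hne : ∏ j ∈ univ.erase i, ((l i : ℚ) - l j) ≠ 0 :=
      Finset.prod_ne_zero_iff.mpr fun j hj => by
        rw [sub_ne_zero]
        exact fun h => Finset.ne_of_mem_erase hj (hinj (Nat.cast_injective h)).symm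
    have hu : (fun j => ((Function.update (fun j => (l j : ℤ)) i (l i - k) j : ℤ) : ℚ)) =
        Function.update (fun j => (l j : ℚ)) i (l i - k) := by
      ext j
      rcases eq_or_ne j i with rfl | hj
      · simp
      · simp [hj]
    rw [hu, Finset.prod_div_distrib, ← mul_div_assoc, eq_div_iff hne]
    exact det_vandermonde_update_mul (fun j => (l j : ℚ)) i (l i - k)
  simp only [hterm] at h2
  have h1' : (chi n lam (onesPartition n) : ℚ) ≠ 0 := by
    intro h0
    rw [h0, zero_mul] at h1
    exact mul_ne_zero (mul_ne_zero hε0' hn) hD h1.symm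
  rw [chihat, div_eq_iff h1']
  refine mul_right_cancel₀ hF ?_
  rw [mul_assoc, h2, mul_assoc _ (chi n lam (onesPartition n) : ℚ), h1, ← hnk, Finset.mul_sum,
    Finset.mul_sum, Finset.sum_mul]
  refine Finset.sum_congr rfl fun i _ => ?_
  ring

theorem algebraMap_laurentSeries (c : ℚ) : algebraMap ℚ (LaurentSeries ℚ) c = HahnSeries.C c :=
  RingHom.congr_fun (RingHom.ext_rat _ _) c

theorem aeval_xInfty_coeff_one (Q : Polynomial ℚ) : (Polynomial.aeval xInfty Q).coeff 1 = 0 := by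
  rw [Polynomial.aeval_eq_sum_range, HahnSeries.coeff_sum]
  refine Finset.sum_eq_zero fun i _ => ?_
  rw [Algebra.smul_def, algebraMap_laurentSeries, HahnSeries.C_mul_eq_smul, HahnSeries.coeff_smul,
    xInfty, HahnSeries.single_pow, HahnSeries.coeff_single_of_ne, smul_zero]
  simp
  omega

theorem exists_aeval_xInfty_mul_eq_one (c : ℚ) : ∃ y : LaurentSeries ℚ,
    Polynomial.aeval xInfty (Polynomial.X - Polynomial.C c) * y = 1 ∧ y.coeff 1 = 1 := by
  set G : PowerSeries ℚ := PowerSeries.mk fun n => c ^ n with hG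
  have hG1 : (1 - PowerSeries.C c * PowerSeries.X) * G = 1 := by
    ext n
    rcases n with _ | n
    · simp [sub_mul, hG, mul_assoc]
    · simp [sub_mul, hG, mul_assoc, PowerSeries.coeff_succ_X_mul, PowerSeries.coeff_one, pow_succ']
  refine ⟨HahnSeries.ofPowerSeries ℤ ℚ (PowerSeries.X * G), ?_, ?_⟩
  · have hx : xInfty * HahnSeries.ofPowerSeries ℤ ℚ PowerSeries.X = 1 := by
      rw [HahnSeries.ofPowerSeries_X, xInfty, HahnSeries.single_mul_single]
      simp
    have h2 := congrArg (HahnSeries.ofPowerSeries ℤ ℚ) hG1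
    simp only [map_mul, map_sub, map_one, HahnSeries.ofPowerSeries_C] at h2
    rw [map_sub, Polynomial.aeval_X, Polynomial.aeval_C, algebraMap_laurentSeries, map_mul]
    linear_combination h2 + HahnSeries.ofPowerSeries ℤ ℚ G * hx
  · have := HahnSeries.ofPowerSeries_apply_coeff (Γ := ℤ) (PowerSeries.X * G) 1
    rw [Nat.cast_one] at this
    rw [this, PowerSeries.coeff_succ_X_mul]
    simp [hG]

theorem aeval_xInfty_X_sub_C_ne_zero (c : ℚ) :
    Polynomial.aeval xInfty (Polynomial.X - Polynomial.C c) ≠ 0 := by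
  obtain ⟨y, hy, -⟩ := exists_aeval_xInfty_mul_eq_one c
  exact left_ne_zero_of_mul_eq_one hy

theorem coeff_one_inv_aeval_xInfty_X_sub_C (c : ℚ) :
    (Polynomial.aeval xInfty (Polynomial.X - Polynomial.C c))⁻¹.coeff 1 = 1 := by
  obtain ⟨y, hy, hy1⟩ := exists_aeval_xInfty_mul_eq_one c
  rw [inv_eq_of_mul_eq_one_right hy, hy1]

theorem coeff_one_aeval_xInfty_mul_inv_nodal {ι : Type*} [DecidableEq ι] (s : Finset ι) (v : ι → ℚ)
    (hv : Set.InjOn v s) (A : Polynomial ℚ) :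
    (Polynomial.aeval xInfty A * (Polynomial.aeval xInfty (Lagrange.nodal s v))⁻¹).coeff 1 =
      ∑ i ∈ s, A.eval (v i) / ∏ j ∈ s.erase i, (v i - v j) := by
  set B := Lagrange.nodal s v with hB
  have hB0 : Polynomial.aeval xInfty B ≠ 0 := by
    rw [hB, Lagrange.nodal_eq, map_prod, Finset.prod_ne_zero_iff]
    exact fun i _ => aeval_xInfty_X_sub_C_ne_zero _
  have hBm : B.Monic := Lagrange.nodal_monic
  set R := A %ₘ B with hR
  have hRdeg : R.degree < #s := by
    rw [← Lagrange.degree_nodal (v := v)]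
    exact Polynomial.degree_modByMonic_lt A hBm
  have hReval (i : ι) (hi : i ∈ s) : R.eval (v i) = A.eval (v i) := by
    conv_rhs => rw [← Polynomial.modByMonic_add_div A B]
    rw [Polynomial.eval_add, Polynomial.eval_mul, hB, Lagrange.eval_nodal_at_node hi, zero_mul,
      add_zero]
  have hA : Polynomial.aeval xInfty A * (Polynomial.aeval xInfty B)⁻¹ =
      Polynomial.aeval xInfty R * (Polynomial.aeval xInfty B)⁻¹ +
        Polynomial.aeval xInfty (A /ₘ B) := by
    conv_lhs => rw [← Polynomial.modByMonic_add_div A B]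
    rw [map_add, map_mul, ← hR]
    field_simp
  have hRsum : Polynomial.aeval xInfty R * (Polynomial.aeval xInfty B)⁻¹ =
      ∑ i ∈ s, HahnSeries.C (A.eval (v i) / ∏ j ∈ s.erase i, (v i - v j)) *
        (Polynomial.aeval xInfty (Polynomial.X - Polynomial.C (v i)))⁻¹ := by
    rw [Lagrange.eq_interpolate hv hRdeg, Lagrange.interpolate_apply, map_sum, Finset.sum_mul]
    refine Finset.sum_congr rfl fun i hi => ?_
    have hb : Lagrange.basis s v i =
        Polynomial.C (∏ j ∈ s.erase i, (v i - v j))⁻¹ * Lagrange.nodal (s.erase i) v := by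
      rw [Lagrange.basis, Lagrange.nodal_eq, ← Finset.prod_inv_distrib, map_prod,
        ← Finset.prod_mul_distrib]
      rfl
    have hn := Lagrange.nodal_eq_mul_nodal_erase (v := v) hi
    have hne : Polynomial.aeval xInfty (Lagrange.nodal (s.erase i) v) ≠ 0 := by
      rw [Lagrange.nodal_eq, map_prod, Finset.prod_ne_zero_iff]
      exact fun i _ => aeval_xInfty_X_sub_C_ne_zero _
    have hne' := aeval_xInfty_X_sub_C_ne_zero (v i)
    rw [hReval i hi, hb, hB, hn, div_eq_mul_inv]
    simp only [map_mul, Polynomial.aeval_C, algebraMap_laurentSeries]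
    field_simp
  rw [hA, HahnSeries.coeff_add, aeval_xInfty_coeff_one, add_zero, hRsum, HahnSeries.coeff_sum]
  refine Finset.sum_congr rfl fun i _ => ?_
  rw [HahnSeries.C_mul_eq_smul, HahnSeries.coeff_smul, coeff_one_inv_aeval_xInfty_X_sub_C,
    smul_eq_mul, mul_one]

theorem prod_range_sub_telescope {R : Type*} [CommRing R] (x : R) (k p : ℕ) :
    (∏ s ∈ range p, (x - k - s)) * ∏ j ∈ range k, (x - j) =
      (∏ j ∈ range k, (x - p - j)) * ∏ s ∈ range p, (x - s) := by
  have h1 := Finset.prod_range_add (fun j : ℕ => x - j) k p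
  have h2 := Finset.prod_range_add (fun j : ℕ => x - j) p k
  rw [add_comm p k, h1] at h2
  simp only [Nat.cast_add, ← sub_sub] at h2
  rw [mul_comm, h2, mul_comm]

theorem cast_descFactorial_eq_prod_range (a k : ℕ) :
    (a.descFactorial k : ℚ) = ∏ j ∈ range k, ((a : ℚ) - j) := by
  rw [← descPochhammer_eval_eq_descFactorial, descPochhammer_eval_eq_prod_range]

theorem eval_fallPoly_zero (a k : ℕ) : (fallPoly 0 k).eval (a : ℚ) = a.descFactorial k := by
  simp [fallPoly, Polynomial.eval_prod, cast_descFactorial_eq_prod_range]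

theorem prod_erase_eq_prod_ite {ι : Type*} [DecidableEq ι] (s : Finset ι) (f : ι → ℚ) {i : ι}
    (hi : i ∈ s) : ∏ j ∈ s.erase i, f j = ∏ j ∈ s, if j = i then 1 else f j := by
  rw [← Finset.mul_prod_erase s _ hi, if_pos rfl, one_mul]
  exact Finset.prod_congr rfl fun j hj => by rw [if_neg (Finset.ne_of_mem_erase hj)]

/-- The sum `∑ᵢ (lᵢ)_k ∏_{j ≠ i} (lᵢ - k - lⱼ) / (lᵢ - lⱼ)` over `i, j < n`. -/
noncomputable def cycleSum (k n : ℕ) (l : ℕ → ℕ) : ℚ :=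
  ∑ i ∈ range n, ((l i).descFactorial k : ℚ) *
    ∏ j ∈ range n, if j = i then 1 else ((l i : ℚ) - k - l j) / (l i - l j)

theorem cycleSum_add {k P d : ℕ} (hk : 1 ≤ k) {l h : ℕ → ℕ} (hl : ∀ j < P, l j = h j + d)
    (hl' : ∀ j < d, l (P + j) = d - 1 - j) : cycleSum k (P + d) l = cycleSum k P h := by
  rw [cycleSum, cycleSum, Finset.sum_range_add, add_eq_left.mpr]
  · refine Finset.sum_congr rfl fun i hi => ?_
    have hi := Finset.mem_range.mp hi
    have h1 : ∏ j ∈ range P, (if j = i then 1 else ((l i : ℚ) - k - l j) / (l i - l j)) =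
        ∏ j ∈ range P, if j = i then 1 else ((h i : ℚ) - k - h j) / (h i - h j) := by
      refine Finset.prod_congr rfl fun j hj => ?_
      rw [hl i hi, hl j (Finset.mem_range.mp hj)]
      push_cast
      congr 2 <;> ring
    have h2 : (∏ j ∈ range d, if P + j = i then 1 else
        ((l i : ℚ) - k - l (P + j)) / (l i - l (P + j))) =
        (∏ s ∈ range d, ((l i : ℚ) - k - s)) / ∏ s ∈ range d, ((l i : ℚ) - s) := by
      rw [← Finset.prod_div_distrib,
        ← Finset.prod_range_reflect (fun s : ℕ => ((l i : ℚ) - k - s) / (l i - s))]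
      refine Finset.prod_congr rfl fun j hj => ?_
      rw [if_neg (by omega), hl' j (Finset.mem_range.mp hj)]
    have h3 : ∏ s ∈ range d, ((l i : ℚ) - s) ≠ 0 := by
      refine Finset.prod_ne_zero_iff.mpr fun s hs => ?_
      have hs := Finset.mem_range.mp hs
      rw [sub_ne_zero]
      have := hl i hi
      exact_mod_cast (by omega : l i ≠ s)
    have h4 : (∏ s ∈ range d, ((l i : ℚ) - k - s)) * (l i).descFactorial k =
        (h i).descFactorial k * ∏ s ∈ range d, ((l i : ℚ) - s) := by
      rw [cast_descFactorial_eq_prod_range, prod_range_sub_telescope,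
        cast_descFactorial_eq_prod_range, hl i hi]
      push_cast
      simp
    rw [Finset.prod_range_add, h1, h2, mul_comm (∏ j ∈ range P, _), ← mul_assoc]
    congr 1
    rw [← mul_div_assoc, div_eq_iff h3, ← h4, mul_comm]
  · refine Finset.sum_eq_zero fun t ht => ?_
    have ht := Finset.mem_range.mp ht
    by_cases hlt : l (P + t) < k
    · rw [Nat.descFactorial_of_lt hlt]
      simp
    · rw [hl' t ht] at hlt
      rw [Finset.prod_eq_zero (i := P + (t + k)) (by simp; omega), mul_zero]
      rw [if_neg (by omega), hl' t ht, hl' (t + k) (by omega)]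
      have : ((d - 1 - t : ℕ) : ℚ) = (d - 1 - (t + k) : ℕ) + k := by
        exact_mod_cast (by omega : d - 1 - t = d - 1 - (t + k) + k)
      rw [this]
      simp

theorem cycleSum_eq_coeff {k P : ℕ} (hk : 1 ≤ k) {h : ℕ → ℕ}
    (hinj : Set.InjOn h (range P)) :
    cycleSum k P h = -(1 / (k : ℚ)) *
      (Polynomial.aeval xInfty (fallPoly 0 k *
          ∏ j ∈ range P, (Polynomial.X - Polynomial.C ((k : ℚ) + h j))) *
        (Polynomial.aeval xInfty
          (∏ j ∈ range P, (Polynomial.X - Polynomial.C (h j : ℚ))))⁻¹).coeff 1 := by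
  have hv : Set.InjOn (fun j => (h j : ℚ)) (range P) := fun a ha b hb hab =>
    hinj ha hb (Nat.cast_injective hab)
  have := coeff_one_aeval_xInfty_mul_inv_nodal (range P) (fun j => (h j : ℚ)) hv
    (fallPoly 0 k * ∏ j ∈ range P, (Polynomial.X - Polynomial.C ((k : ℚ) + h j)))
  rw [Lagrange.nodal_eq] at this
  have hk0 : (k : ℚ) ≠ 0 := by positivity
  rw [this, cycleSum, Finset.mul_sum]
  refine Finset.sum_congr rfl fun i hi => ?_
  rw [Polynomial.eval_mul, eval_fallPoly_zero, Polynomial.eval_prod,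
    ← prod_erase_eq_prod_ite _ _ hi, ← Finset.mul_prod_erase (range P) _ hi, Finset.prod_div_distrib]
  simp only [Polynomial.eval_sub, Polynomial.eval_X, Polynomial.eval_C, ← sub_sub]
  field_simp
  ring

theorem prod_X_sub_C_telescope (c : ℚ) (k p : ℕ) :
    fallPoly (c + p) k * ∏ s ∈ range p, (Polynomial.X - Polynomial.C (c + s)) =
      (∏ s ∈ range p, (Polynomial.X - Polynomial.C ((k : ℚ) + (c + s)))) * fallPoly c k := by
  have := prod_range_sub_telescope (Polynomial.X - Polynomial.C c : Polynomial ℚ) k p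
  rw [fallPoly, fallPoly]
  convert this.symm using 2 <;> refine Finset.prod_congr rfl fun s _ => ?_ <;>
    simp only [map_add, map_natCast] <;> ring

theorem aeval_xInfty_fallPoly_ne_zero (c : ℚ) (k : ℕ) :
    Polynomial.aeval xInfty (fallPoly c k) ≠ 0 := by
  rw [fallPoly, map_prod, Finset.prod_ne_zero_iff]
  exact fun i _ => aeval_xInfty_X_sub_C_ne_zero _

theorem sum_eq_sum_lt_add_add_sum_gt {m : ℕ} (p : Fin m → ℕ) (i : Fin m) :
    ∑ j, p j = ∑ j : Fin i, p (Fin.castLE i.2.le j) + p i + ∑ j ∈ univ.filter (i < ·), p j := by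
  have h1 : ∑ j : Fin i, p (Fin.castLE i.2.le j) = ∑ j ∈ univ.filter (· < i), p j := by
    refine Finset.sum_bij (fun j _ => Fin.castLE i.2.le j) ?_ ?_ ?_ ?_
    · exact fun j _ => Finset.mem_filter.mpr ⟨mem_univ _, j.2⟩
    · intro a _ b _ hab
      simpa using hab
    · intro b hb
      exact ⟨⟨b, (Finset.mem_filter.mp hb).2⟩, mem_univ _, rfl⟩
    · intros
      rfl
  rw [h1, ← Finset.add_sum_erase univ p (mem_univ i), ← Finset.sum_filter_add_sum_filter_not
    (univ.erase i) (· < i)]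
  have h2 : (univ.erase i).filter (· < i) = univ.filter (· < i) := by
    ext j
    simp only [mem_filter, mem_erase, mem_univ]
    grind
  have h3 : (univ.erase i).filter (¬ · < i) = univ.filter (i < ·) := by
    ext j
    simp only [mem_filter, mem_erase, mem_univ]
    grind
  rw [h2, h3]
  ring

/-- The length of row `j` of the union of the rectangles `pᵢ × qᵢ`, for `j < ∑ pᵢ`. -/
def rectRow {m : ℕ} (p q : Fin m → ℕ) (j : Fin (∑ i, p i)) : ℕ := q (finSigmaFinEquiv.symm j).1

theorem fst_le_fst_of_finSigmaFinEquiv_le {m : ℕ} {p : Fin m → ℕ} {x y : (i : Fin m) × Fin (p i)}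
    (h : finSigmaFinEquiv x ≤ finSigmaFinEquiv y) : x.1 ≤ y.1 := by
  by_contra! hlt
  have h' : (finSigmaFinEquiv x : ℕ) ≤ finSigmaFinEquiv y := h
  rw [finSigmaFinEquiv_apply, finSigmaFinEquiv_apply] at h'
  have h1 := sum_eq_sum_lt_add_add_sum_gt p x.1
  have h2 := sum_eq_sum_lt_add_add_sum_gt p y.1
  have h3 : p x.1 + ∑ j ∈ univ.filter (x.1 < ·), p j ≤ ∑ j ∈ univ.filter (y.1 < ·), p j := by
    rw [← Finset.sum_insert (by simp)]
    refine Finset.sum_le_sum_of_subset fun j hj => ?_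
    rcases Finset.mem_insert.mp hj with rfl | hj
    · simpa using hlt
    · simp only [mem_filter, mem_univ, true_and] at hj ⊢
      exact hlt.trans hj
  have := y.2.2
  omega

theorem rectRow_antitone {m : ℕ} {p q : Fin m → ℕ} (hmono : Antitone q) :
    Antitone (rectRow p q) := fun a b hab =>
  hmono (fst_le_fst_of_finSigmaFinEquiv_le (by simpa using hab))

theorem nthPart_rectShape {m : ℕ} {p q : Fin m → ℕ} (hq : ∀ i, 0 < q i) (hmono : Antitone q)
    (j : ℕ) : nthPart (rectShape m p q hq) j =
      if h : j < ∑ i, p i then rectRow p q ⟨j, h⟩ else 0 := by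
  have hparts : (rectShape m p q hq).parts = (List.ofFn (rectRow p q) : Multiset ℕ) := by
    have h1 : (List.ofFn (rectRow p q) : Multiset ℕ) = univ.val.map (rectRow p q) := by
      rw [Fin.univ_val_map]
    have h2 : univ.val.map (rectRow p q) = ∑ j, {rectRow p q j} :=
      (Multiset.sum_map_singleton _).symm.trans (by rw [Multiset.map_map]; rfl)
    rw [h1, h2, ← Equiv.sum_comp finSigmaFinEquiv, Fintype.sum_sigma]
    simp [rectShape, rectRow, Multiset.nsmul_singleton]
  have hsort : ((rectShape m p q hq).parts.sort (· ≤ ·)).reverse = List.ofFn (rectRow p q) := by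
    refine List.Perm.eq_of_pairwise' (r := (· ≥ ·)) ?_ ?_ ?_
    · rw [List.pairwise_reverse]
      exact Multiset.pairwise_sort _ _
    · exact List.pairwise_ofFn.mpr fun a b hab => rectRow_antitone hmono hab.le
    · refine (List.reverse_perm _).trans ?_
      rw [← Multiset.coe_eq_coe, Multiset.sort_eq, hparts]
  rw [nthPart, hsort, List.getD_eq_getElem?_getD, List.getElem?_ofFn]
  split_ifs <;> rfl

/-- The shifted row lengths `λⱼ + P - 1 - j` of the union of rectangles, where `P = ∑ pᵢ` is its
number of rows (and `0` for `j ≥ P`). -/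
def rectBeta {m : ℕ} (p q : Fin m → ℕ) (j : ℕ) : ℕ :=
  if h : j < ∑ i, p i then rectRow p q ⟨j, h⟩ + (∑ i, p i - 1 - j) else 0

theorem rectBeta_lt_rectBeta {m : ℕ} {p q : Fin m → ℕ} (hmono : Antitone q) {a b : ℕ} (hab : a < b)
    (hb : b < ∑ i, p i) : rectBeta p q b < rectBeta p q a := by
  rw [rectBeta, rectBeta, dif_pos hb, dif_pos (hab.trans hb)]
  have : rectRow p q ⟨b, hb⟩ ≤ rectRow p q ⟨a, hab.trans hb⟩ :=
    rectRow_antitone hmono (Fin.mk_le_mk.mpr hab.le)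
  omega

theorem prod_range_rectBeta {m : ℕ} (p q : Fin m → ℕ) {R : Type*} [CommMonoid R] (f : ℕ → R) :
    ∏ j ∈ range (∑ i, p i), f (rectBeta p q j) =
      ∏ i, ∏ s ∈ range (p i), f (q i + ∑ j ∈ univ.filter (i < ·), p j + s) := by
  rw [Finset.prod_range, ← Equiv.prod_comp finSigmaFinEquiv, Fintype.prod_sigma]
  refine Finset.prod_congr rfl fun i _ => ?_
  rw [← Finset.prod_range_reflect, Finset.prod_range]
  refine Finset.prod_congr rfl fun s _ => ?_
  congr 1
  rw [rectBeta, dif_pos (Fin.is_lt _)]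
  have h1 := sum_eq_sum_lt_add_add_sum_gt p i
  have h2 := finSigmaFinEquiv_apply (n := p) ⟨i, s⟩
  have h3 : rectRow p q (finSigmaFinEquiv ⟨i, s⟩) = q i := by simp [rectRow]
  have := s.2
  rw [Fin.eta, h3]
  simp only at h2
  omega

theorem sum_rectRow {m : ℕ} (p q : Fin m → ℕ) : ∑ j, rectRow p q j = rectN m p q := by
  rw [← Equiv.sum_comp finSigmaFinEquiv, Fintype.sum_sigma]
  simp [rectRow, rectN]

theorem prod_rectBeta_telescope {m : ℕ} (p q : Fin m → ℕ) (k : ℕ) :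
    (∏ i : Fin m,
      fallPoly ((q i : ℚ) + ∑ j ∈ Finset.univ.filter (fun j => i ≤ j), (p j : ℚ)) k) *
        ∏ j ∈ range (∑ i, p i), (Polynomial.X - Polynomial.C (rectBeta p q j : ℚ)) =
      (∏ j ∈ range (∑ i, p i), (Polynomial.X - Polynomial.C ((k : ℚ) + rectBeta p q j))) *
        ∏ i : Fin m,
          fallPoly ((q i : ℚ) + ∑ j ∈ Finset.univ.filter (fun j => i < j), (p j : ℚ)) k := by
  rw [prod_range_rectBeta p q fun a => Polynomial.X - Polynomial.C (a : ℚ),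
    prod_range_rectBeta p q fun a => Polynomial.X - Polynomial.C ((k : ℚ) + a),
    ← Finset.prod_mul_distrib, ← Finset.prod_mul_distrib]
  refine Finset.prod_congr rfl fun i _ => ?_
  have h1 : univ.filter (fun j => i ≤ j) = insert i (univ.filter (fun j => i < j)) := by
    ext j
    simp only [mem_filter, mem_insert, mem_univ]
    grind
  rw [h1, Finset.sum_insert (by simp), add_comm (p i : ℚ), ← add_assoc]
  push_cast
  exact prod_X_sub_C_telescope _ k (p i)

theorem chihat_rectShape_eq_cycleSum {k m : ℕ} (hk : 1 ≤ k) {p q : Fin m → ℕ} (hq : ∀ i, 0 < q i)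
    (hmono : Antitone q) (hkn : k ≤ rectN m p q) :
    chihat (rectN m p q) hkn (rectShape m p q hq) (singlePart k hk) =
      cycleSum k (∑ i, p i) (rectBeta p q) := by
  set n := rectN m p q with hn
  set P := ∑ i, p i with hP
  have hPn : P ≤ n := Finset.sum_le_sum fun i _ => Nat.le_mul_of_pos_right _ (hq i)
  obtain ⟨r, hr⟩ : ∃ r : ℕ → ℕ, ∀ j, nthPart (rectShape m p q hq) j = r j := ⟨_, fun _ => rfl⟩
  have hrP (j : ℕ) (hj : j < P) : r j = rectRow p q ⟨j, hj⟩ := by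
    rw [← hr, nthPart_rectShape hq hmono, dif_pos hj]
  have hrP' (j : ℕ) (hj : P ≤ j) : r j = 0 := by
    rw [← hr, nthPart_rectShape hq hmono, dif_neg (not_lt.mpr hj)]
  set l : ℕ → ℕ := fun j => r j + (n - 1 - j) with hl
  have hlP (j : ℕ) (hj : j < P) : l j = rectBeta p q j + (n - P) := by
    simp only [hl]
    rw [hrP j hj, rectBeta, dif_pos hj]
    omega
  have hlP' (j : ℕ) (hj : P ≤ j) : l j = n - 1 - j := by
    simp only [hl]
    rw [hrP' j hj, zero_add]
  have hanti {a b : ℕ} (hab : a < b) (hb : b < n) : l b < l a := by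
    rcases lt_or_ge b P with h | h
    · rw [hlP b h, hlP a (hab.trans h)]
      have := rectBeta_lt_rectBeta hmono hab h
      omega
    · rw [hlP' b h]
      simp only [hl]
      omega
  have hinj : Function.Injective fun i : Fin n => l i := by
    intro a b hab
    rcases lt_trichotomy (a : ℕ) b with h | h | h
    · exact absurd hab (hanti h b.2).ne'
    · exact Fin.ext h
    · exact absurd hab (hanti h a.2).ne
  have hsum : ∑ i : Fin n, l i = n + ∑ i : Fin n, (i : ℕ) := by
    simp only [hl, Finset.sum_add_distrib]
    congr 1
    · have h1 : ∑ j ∈ range (P + (n - P)), r j = n := by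
        rw [Finset.sum_range_add, Finset.sum_eq_zero (s := range (n - P))
          fun j _ => hrP' _ (Nat.le_add_right _ _), add_zero, Finset.sum_range, hn,
          ← sum_rectRow p q]
        exact Finset.sum_congr rfl fun j _ => hrP j j.2
      rw [Nat.add_sub_cancel' hPn] at h1
      rw [← Finset.sum_range r, h1]
    · rw [← Finset.sum_range fun j => n - 1 - j, ← Finset.sum_range fun j => j,
        Finset.sum_range_reflect (fun j => j)]
  rw [chihat_singlePart_eq_sum hk hkn (l := fun i => l i) (fun i => by rw [hr]) hsum hinj]
  have hcycle : ∑ i : Fin n, ((l i).descFactorial k : ℚ) *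
      ∏ j ∈ univ.erase i, (((l i : ℚ) - k - l j) / (l i - l j)) = cycleSum k n l := by
    rw [cycleSum, Finset.sum_range]
    refine Finset.sum_congr rfl fun i _ => ?_
    rw [prod_erase_eq_prod_ite _ _ (mem_univ i), Finset.prod_range]
    simp only [Fin.ext_iff]
  rw [hcycle, ← Nat.add_sub_cancel' hPn]
  refine cycleSum_add hk hlP fun j hj => ?_
  rw [hlP' _ (Nat.le_add_right _ _)]
  omega

/-- For `λ` the union of `m` rectangles `pᵢ × qᵢ` and `k ≤ n`, the
normalized character at a `k`-cycle is
`F_k(p;q) = -(1/k) [x^{-1}] (x)_k ∏ᵢ (x-(qᵢ+pᵢ+⋯+p_m))_k / ∏ᵢ (x-(qᵢ+p_{i+1}+⋯+p_m))_k`,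
where `[x^{-1}]` is taken in the Laurent expansion at `x = ∞`. -/
theorem stmt3 (k m : ℕ) (hk : 1 ≤ k) (hm : 1 ≤ m) (p q : Fin m → ℕ)
    (hp : ∀ i, 0 < p i) (hq : ∀ i, 0 < q i) (hmono : Antitone q)
    (hkn : k ≤ rectN m p q) :
    chihat (rectN m p q) hkn (rectShape m p q hq) (singlePart k hk) =
      -(1 / (k : ℚ)) *
        ((Polynomial.aeval xInfty
            (fallPoly 0 k *
              ∏ i : Fin m,
                fallPoly ((q i : ℚ) + ∑ j ∈ Finset.univ.filter (fun j => i ≤ j), (p j : ℚ)) k)) *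
          (Polynomial.aeval xInfty
            (∏ i : Fin m,
              fallPoly ((q i : ℚ) + ∑ j ∈ Finset.univ.filter (fun j => i < j), (p j : ℚ)) k))⁻¹).coeff
          (1 : ℤ) := by
  rw [chihat_rectShape_eq_cycleSum hk hq hmono hkn, cycleSum_eq_coeff hk]
  · congr 2
    have h1 : Polynomial.aeval xInfty (∏ j ∈ range (∑ i, p i),
        (Polynomial.X - Polynomial.C (rectBeta p q j : ℚ))) ≠ 0 := by
      rw [map_prod, Finset.prod_ne_zero_iff]
      exact fun j _ => aeval_xInfty_X_sub_C_ne_zero _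
    have h2 : Polynomial.aeval xInfty (∏ i : Fin m,
        fallPoly ((q i : ℚ) + ∑ j ∈ Finset.univ.filter (fun j => i < j), (p j : ℚ)) k) ≠ 0 := by
      rw [map_prod, Finset.prod_ne_zero_iff]
      exact fun i _ => aeval_xInfty_fallPoly_ne_zero _ _
    rw [← div_eq_mul_inv, ← div_eq_mul_inv, div_eq_div_iff h1 h2, ← map_mul, ← map_mul, mul_assoc,
      mul_assoc, prod_rectBeta_telescope]
  · intro a ha b hb hab
    simp only [coe_range, Set.mem_Iio] at ha hb
    rcases lt_trichotomy a b with h | h | h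
    · exact absurd hab (rectBeta_lt_rectBeta hmono h hb).ne'
    · exact h
    · exact absurd hab (rectBeta_lt_rectBeta hmono h ha).ne
end
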